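/- Let T = X + iY satisfy assumption (A) and fix ψ either in C¹₁([a,b]) or a polynomial. Then there exists a unique function ξ(·; ψ) ∈ L¹([a,b]) such that for every φ in the same class, −i Tr([ψ(Y), φ(X)]) = ∫_a^b φ′(t) ξ(t; ψ) dt. Moreover ∫_a^b |ξ(t; ψ)| dt ≤ ‖−i[ψ(Y), X]‖₁ and ∫_a^b ξ(t; ψ) dt = Tr(ψ′(Y) D²); and if ψ′ ≥ 0 on [a,b], then ξ(t; ψ) ≥ 0 for almost all t ∈ [a,b]. -/

import Mathlib

open scoped InnerProductSpace
open MeasureTheory Polynomial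

namespace HHCP

variable {H : Type*} [NormedAddCommGroup H] [InnerProductSpace ℂ H] [CompleteSpace H]
  [TopologicalSpace.SeparableSpace H]

/-- `f(A)` for a function `f` of a real variable, applied to the (selfadjoint, hence
star-normal) bounded operator `A` via the continuous functional calculus. -/
noncomputable def fc (f : ℝ → ℂ) (A : H →L[ℂ] H) : H →L[ℂ] H :=
  cfc (fun z : ℂ => f z.re) A

/-- `|A| = √(A⋆A)`. -/
noncomputable def absOp (A : H →L[ℂ] H) : H →L[ℂ] H :=
  cfc Real.sqrt (ContinuousLinearMap.adjoint A * A)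

/-- `A` is of trace class, i.e. `∑ ⟪eᵢ, |A| eᵢ⟫ < ∞` (this is independent of the
choice of the Hilbert basis `e`). -/
def IsTraceClass {ι : Type*} (e : HilbertBasis ι ℂ H) (A : H →L[ℂ] H) : Prop :=
  Summable fun i => (⟪e i, absOp A (e i)⟫_ℂ).re

/-- The trace norm `‖A‖₁ = Tr |A|`. -/
noncomputable def traceNorm {ι : Type*} (e : HilbertBasis ι ℂ H) (A : H →L[ℂ] H) : ℝ :=
  ∑' i, (⟪e i, absOp A (e i)⟫_ℂ).re

/-- The trace `Tr A = ∑ᵢ ⟪eᵢ, A eᵢ⟫`. -/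
noncomputable def trace {ι : Type*} (e : HilbertBasis ι ℂ H) (A : H →L[ℂ] H) : ℂ :=
  ∑' i, ⟪e i, A (e i)⟫_ℂ

/-- `T` is hyponormal (`‖T⋆x‖ ≤ ‖Tx‖`, i.e. `[T⋆,T] ≥ 0`) and *purely* so: there is no
nonzero closed subspace, invariant under `T` and `T⋆`, on which `T` is normal. -/
def PurelyHyponormal (T : H →L[ℂ] H) : Prop :=
  (∀ x : H, ‖ContinuousLinearMap.adjoint T x‖ ≤ ‖T x‖) ∧
  ∀ S : Submodule ℂ H, IsClosed (S : Set H) →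
    (∀ x ∈ S, T x ∈ S) → (∀ x ∈ S, ContinuousLinearMap.adjoint T x ∈ S) →
    (∀ x ∈ S, ‖T x‖ = ‖ContinuousLinearMap.adjoint T x‖) → S = ⊥

/-- Assumption (A): `T = X + iY` is purely hyponormal with `X, Y` selfadjoint,
`[T⋆,T] = −2i[Y,X] = 2D²` is a positive trace-class operator, and
`σ(X) ∪ σ(Y) ⊆ [a,b]`. -/
structure AssumptionA {ι : Type*} (e : HilbertBasis ι ℂ H)
    (X Y D2 : H →L[ℂ] H) (a b : ℝ) : Prop where
  hab : a ≤ b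
  hX : IsSelfAdjoint X
  hY : IsSelfAdjoint Y
  hpure : PurelyHyponormal (X + Complex.I • Y)
  hD2 : (2 : ℂ) • D2 = (-(2 : ℂ) * Complex.I) • (Y * X - X * Y)
  hpos : D2.IsPositive
  htc : IsTraceClass e D2
  hspecX : spectrum ℝ X ⊆ Set.Icc a b
  hspecY : spectrum ℝ Y ⊆ Set.Icc a b

/-- `ψ ∈ C¹₁`: `ψ(β) = (2π)^{-1/2} ∫ ψ̂(α) e^{iαβ} dα` for some `ψ̂` with
`∫ |ψ̂(α)|(1+|α|) dα < ∞`. -/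
def MemC11 (ψ : ℝ → ℂ) : Prop :=
  ∃ g : ℝ → ℂ, Integrable g ∧ Integrable (fun α : ℝ => α • g α) ∧
    ∀ β : ℝ, ψ β = (Real.sqrt (2 * Real.pi))⁻¹ •
      ∫ α : ℝ, Complex.exp (Complex.I * (α : ℂ) * (β : ℂ)) • g α

/-- `ψ` is (the function given by) a polynomial with complex coefficients. -/
def IsPolyFun (ψ : ℝ → ℂ) : Prop :=
  ∃ p : Polynomial ℂ, ∀ t : ℝ, ψ t = Polynomial.eval (t : ℂ) p

/-- `ψ` is either in `C¹₁([a,b])` or a polynomial. -/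
def GoodFun (ψ : ℝ → ℂ) : Prop := MemC11 ψ ∨ IsPolyFun ψ

/-- `E` is the spectral measure of the selfadjoint operator `A`: a projection-valued,
countably additive measure on `ℝ` such that `⟪x, f(A) x⟫ = ∫ f dμ_x`, where `μ_x` is the
finite positive measure `μ_x(Δ) = ⟪x, E(Δ) x⟫`. -/
def IsSpectralMeasureOf (A : H →L[ℂ] H) (E : Set ℝ → H →L[ℂ] H) : Prop :=
  (∀ Δ : Set ℝ, IsSelfAdjoint (E Δ)) ∧
  (∀ Δ Ω : Set ℝ, E (Δ ∩ Ω) = E Δ * E Ω) ∧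
  E Set.univ = 1 ∧
  (∀ Δ : ℕ → Set ℝ, (∀ n, MeasurableSet (Δ n)) → Pairwise (Function.onFun Disjoint Δ) →
    ∀ x : H, HasSum (fun n => E (Δ n) x) (E (⋃ n, Δ n) x)) ∧
  ∀ x : H, ∃ μ : Measure ℝ, IsFiniteMeasure μ ∧
    (∀ Δ : Set ℝ, MeasurableSet Δ → (μ Δ).toReal = (⟪x, E Δ x⟫_ℂ).re) ∧
    ∀ f : ℝ → ℝ, Continuous f → (⟪x, cfc f A x⟫_ℂ).re = ∫ t, f t ∂μ

/-- An indefinite integral `𝒥(χ_Δ)` of the characteristic function of `Δ`. -/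
noncomputable def Jind (a : ℝ) (Δ : Set ℝ) (t : ℝ) : ℝ :=
  ∫ s in a..t, Set.indicator Δ (fun _ => (1 : ℝ)) s

/-- `𝒥(χ_Δ)(A)`. -/
noncomputable def JindOp (a : ℝ) (Δ : Set ℝ) (A : H →L[ℂ] H) : H →L[ℂ] H :=
  fc (fun t => (Jind a Δ t : ℂ)) A

/-- `ψ ∈ C¹([a,b])` with derivative `ψd` on `[a,b]`. -/
def HasDerivOnIcc (ψ ψd : ℝ → ℂ) (a b : ℝ) : Prop :=
  (∀ t ∈ Set.Icc a b, HasDerivWithinAt ψ (ψd t) (Set.Icc a b) t) ∧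
  ContinuousOn ψd (Set.Icc a b)

/-- `r` is a Carey–Pincus principal function for the pair `X, Y`: a nonnegative
`L¹([a,b]²)` function with `Tr(−i[ψ(Y), φ(X)]) = ∫∫ φ′(t) ψ′(λ) r(t,λ) dt dλ`
for all `ψ, φ ∈ C¹([a,b])`. -/
def IsPrincipalFunction {ι : Type*} (e : HilbertBasis ι ℂ H) (X Y : H →L[ℂ] H)
    (a b : ℝ) (r : ℝ → ℝ → ℝ) : Prop :=
  IntegrableOn (fun q : ℝ × ℝ => r q.1 q.2) (Set.Icc a b ×ˢ Set.Icc a b) ∧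
  (∀ᵐ q : ℝ × ℝ ∂(volume : Measure (ℝ × ℝ)),
    q ∈ Set.Icc a b ×ˢ Set.Icc a b → 0 ≤ r q.1 q.2) ∧
  ∀ ψ ψd φ φd : ℝ → ℂ, HasDerivOnIcc ψ ψd a b → HasDerivOnIcc φ φd a b →
    trace e ((-Complex.I) • (fc ψ Y * fc φ X - fc φ X * fc ψ Y)) =
      ∫ t in Set.Icc a b, ∫ l in Set.Icc a b, φd t * ψd l * (r t l : ℂ)

/-- The Jacobian `J(F,G)(t,λ) = ∂F/∂t ∂G/∂λ − ∂F/∂λ ∂G/∂t`. -/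
noncomputable def Jac (F G : ℝ → ℝ → ℂ) (t l : ℝ) : ℂ :=
  deriv (fun s => F s l) t * deriv (fun s => G t s) l -
    deriv (fun s => F t s) l * deriv (fun s => G s l) t

set_option linter.unusedSectionVars false

/-! ### Functional calculus -/

theorem spec_re {A : H →L[ℂ] H} (hA : IsSelfAdjoint A) {z : ℂ} (hz : z ∈ spectrum ℂ A) :
    z.re ∈ spectrum ℝ A ∧ ((z.re : ℝ) : ℂ) = z :=
  ⟨hA.spectrumRestricts.apply_mem hz, (hA.mem_spectrum_eq_re hz).symm⟩

theorem fc_congr {A : H →L[ℂ] H} (hA : IsSelfAdjoint A) {a b : ℝ}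
    (hs : spectrum ℝ A ⊆ Set.Icc a b) {f g : ℝ → ℂ} (h : ∀ t ∈ Set.Icc a b, f t = g t) :
    fc f A = fc g A :=
  cfc_congr fun _ hz => h _ (hs (spec_re hA hz).1)

theorem fc_add {A : H →L[ℂ] H} {f g : ℝ → ℂ} (hf : Continuous f) (hg : Continuous g) :
    fc (fun t => f t + g t) A = fc f A + fc g A :=
  cfc_add A (fun z : ℂ => f z.re) (fun z : ℂ => g z.re)
    (by fun_prop) (by fun_prop)

theorem fc_sub {A : H →L[ℂ] H} {f g : ℝ → ℂ} (hf : Continuous f) (hg : Continuous g) :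
    fc (fun t => f t - g t) A = fc f A - fc g A :=
  cfc_sub (fun z : ℂ => f z.re) (fun z : ℂ => g z.re) A
    (by fun_prop) (by fun_prop)

theorem fc_mul {A : H →L[ℂ] H} {f g : ℝ → ℂ} (hf : Continuous f) (hg : Continuous g) :
    fc (fun t => f t * g t) A = fc f A * fc g A :=
  cfc_mul (fun z : ℂ => f z.re) (fun z : ℂ => g z.re) A
    (by fun_prop) (by fun_prop)

theorem fc_const_mul {A : H →L[ℂ] H} (c : ℂ) {f : ℝ → ℂ} (hf : Continuous f) :
    fc (fun t => c * f t) A = c • fc f A :=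
  cfc_const_mul c (fun z : ℂ => f z.re) A (by fun_prop)

theorem fc_one {A : H →L[ℂ] H} (hA : IsSelfAdjoint A) : fc (fun _ => 1) A = 1 := by
  have := hA.isStarNormal
  exact cfc_const_one ℂ A

theorem fc_id {A : H →L[ℂ] H} (hA : IsSelfAdjoint A) : fc (fun t => (t : ℂ)) A = A := by
  have := hA.isStarNormal
  rw [fc]
  conv_rhs => rw [← cfc_id ℂ A]
  exact cfc_congr fun z hz => (spec_re hA hz).2

theorem fc_poly {A : H →L[ℂ] H} (hA : IsSelfAdjoint A) (p : ℂ[X]) :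
    fc (fun t => p.eval (t : ℂ)) A = aeval A p := by
  have := hA.isStarNormal
  rw [fc, ← cfc_polynomial p A]
  exact cfc_congr fun z hz => by
    show p.eval ((z.re : ℝ) : ℂ) = p.eval z
    rw [(spec_re hA hz).2]

theorem fc_norm_le {A : H →L[ℂ] H} (hA : IsSelfAdjoint A) {a b : ℝ}
    (hs : spectrum ℝ A ⊆ Set.Icc a b) {f : ℝ → ℂ} {c : ℝ} (hc : 0 ≤ c)
    (h : ∀ t ∈ Set.Icc a b, ‖f t‖ ≤ c) : ‖fc f A‖ ≤ c :=
  norm_cfc_le hc fun _ hz => h _ (hs (spec_re hA hz).1)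

theorem fc_adjoint {A : H →L[ℂ] H} (f : ℝ → ℂ) :
    ContinuousLinearMap.adjoint (fc f A) = fc (fun t => star (f t)) A :=
  (cfc_star (fun z : ℂ => f z.re) A).symm

theorem fc_selfAdjoint {A : H →L[ℂ] H} (f : ℝ → ℝ) :
    IsSelfAdjoint (fc (fun t => (f t : ℂ)) A) := by
  rw [ContinuousLinearMap.isSelfAdjoint_iff', fc_adjoint]
  congr 1; ext t; simp

theorem fc_comm {A : H →L[ℂ] H} (f g : ℝ → ℂ) : Commute (fc f A) (fc g A) :=
  cfc_commute_cfc _ _ A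

theorem fc_pos {A : H →L[ℂ] H} (hA : IsSelfAdjoint A) {a b : ℝ}
    (hs : spectrum ℝ A ⊆ Set.Icc a b) {f : ℝ → ℝ} (hf : Continuous f)
    (h : ∀ t ∈ Set.Icc a b, 0 ≤ f t) (x : H) :
    0 ≤ (⟪x, fc (fun t => (f t : ℂ)) A x⟫_ℂ).re := by
  have e1 : fc (fun t => (f t : ℂ)) A =
      fc (fun t => ((Real.sqrt (f t) : ℝ) : ℂ) * ((Real.sqrt (f t) : ℝ) : ℂ)) A :=
    fc_congr hA hs fun t ht => by
      rw [← Complex.ofReal_mul, Real.mul_self_sqrt (h t ht)]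
  have hc : Continuous fun t => ((Real.sqrt (f t) : ℝ) : ℂ) := by fun_prop
  rw [e1, fc_mul hc hc, ContinuousLinearMap.mul_apply]
  have hsa := fc_selfAdjoint (A := A) (fun t => Real.sqrt (f t))
  rw [← ContinuousLinearMap.adjoint_inner_left, ContinuousLinearMap.isSelfAdjoint_iff'.1 hsa]
  exact inner_self_nonneg (𝕜 := ℂ)

theorem fc_real_im {A : H →L[ℂ] H} (f : ℝ → ℝ) (x : H) :
    (⟪x, fc (fun t => (f t : ℂ)) A x⟫_ℂ).im = 0 := by
  have hsa := fc_selfAdjoint (A := A) f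
  rw [← Complex.conj_eq_iff_im, inner_conj_symm]
  conv_rhs => rw [← ContinuousLinearMap.adjoint_inner_left,
    ContinuousLinearMap.isSelfAdjoint_iff'.1 hsa]

/-! ### Nuclear operators, represented by integrals of rank one operators -/

theorem countable_of_basis {ι : Type*} (e : HilbertBasis ι ℂ H) : Countable ι := by
  have hd : ∀ i j, i ≠ j → (2 : ℝ) ≤ ‖e i - e j‖ ^ 2 := by
    intro i j hij
    have h1 := e.orthonormal.1 i
    have h2 := e.orthonormal.1 j
    have h3 : ⟪e i, e j⟫_ℂ = 0 := e.orthonormal.2 hij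
    rw [@norm_sub_sq ℂ, h1, h2, h3]; norm_num
  refine Pairwise.countable_of_isOpen_disjoint (s := fun i => Metric.ball (e i) (1 / 2)) ?_
    (fun i => Metric.isOpen_ball) (fun i => ⟨e i, Metric.mem_ball_self (by norm_num)⟩)
  intro i j hij
  refine Metric.ball_disjoint_ball ?_
  rw [dist_eq_norm]
  have := hd i j hij
  nlinarith [norm_nonneg (e i - e j)]

/-- `A = ∫ ⟨v(ω), ·⟩ u(ω) dμ(ω)`. -/
structure Rep {Ω : Type*} [MeasurableSpace Ω] (μ : Measure Ω) (u v : Ω → H)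
    (A : H →L[ℂ] H) : Prop where
  hu : AEStronglyMeasurable u μ
  hv : AEStronglyMeasurable v μ
  int : Integrable (fun ω => ‖u ω‖ * ‖v ω‖) μ
  eq : ∀ x y : H, ⟪x, A y⟫_ℂ = ∫ ω, ⟪x, u ω⟫_ℂ * ⟪v ω, y⟫_ℂ ∂μ

section Rep
variable {Ω : Type*} [MeasurableSpace Ω] {μ : Measure Ω} {u v : Ω → H} {A : H →L[ℂ] H}

theorem Rep.integrable (h : Rep μ u v A) (x y : H) :
    Integrable (fun ω => ⟪x, u ω⟫_ℂ * ⟪v ω, y⟫_ℂ) μ := by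
  refine (h.int.const_mul (‖x‖ * ‖y‖)).mono'
    ((aestronglyMeasurable_const.inner h.hu).mul (h.hv.inner aestronglyMeasurable_const)) ?_
  refine Filter.Eventually.of_forall fun ω => ?_
  rw [norm_mul]
  calc ‖⟪x, u ω⟫_ℂ‖ * ‖⟪v ω, y⟫_ℂ‖ ≤ (‖x‖ * ‖u ω‖) * (‖v ω‖ * ‖y‖) := by
        gcongr <;> exact norm_inner_le_norm _ _
    _ = _ := by ring

theorem Rep.left (h : Rep μ u v A) (B : H →L[ℂ] H) : Rep μ (fun ω => B (u ω)) v (B * A) := by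
  have hu := B.continuous.comp_aestronglyMeasurable h.hu
  refine ⟨hu, h.hv, ?_, ?_⟩
  · refine (h.int.const_mul ‖B‖).mono' (hu.norm.mul h.hv.norm) ?_
    refine Filter.Eventually.of_forall fun ω => ?_
    rw [Real.norm_of_nonneg (by positivity), ← mul_assoc]
    gcongr; exact B.le_opNorm _
  · intro x y
    rw [mul_apply_eq_comp, ← ContinuousLinearMap.adjoint_inner_left, h.eq]
    simp only [ContinuousLinearMap.adjoint_inner_left]

theorem Rep.right (h : Rep μ u v A) (B : H →L[ℂ] H) :
    Rep μ u (fun ω => ContinuousLinearMap.adjoint B (v ω)) (A * B) := by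
  have hv := (ContinuousLinearMap.adjoint B).continuous.comp_aestronglyMeasurable h.hv
  refine ⟨h.hu, hv, ?_, ?_⟩
  · refine (h.int.const_mul ‖ContinuousLinearMap.adjoint B‖).mono' (h.hu.norm.mul hv.norm) ?_
    refine Filter.Eventually.of_forall fun ω => ?_
    rw [Real.norm_of_nonneg (by positivity)]
    calc _ ≤ ‖u ω‖ * (‖ContinuousLinearMap.adjoint B‖ * ‖v ω‖) := by
          gcongr; exact ContinuousLinearMap.le_opNorm _ _
      _ = _ := by ring
  · intro x y
    rw [mul_apply_eq_comp, h.eq]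
    simp only [ContinuousLinearMap.adjoint_inner_left]

theorem sum_inner_le {ι : Type*} (e : HilbertBasis ι ℂ H) (F : Finset ι) (x y : H) :
    ∑ i ∈ F, ‖⟪e i, x⟫_ℂ * ⟪y, e i⟫_ℂ‖ ≤ ‖x‖ * ‖y‖ := by
  have h1 := e.orthonormal.sum_inner_products_le x (s := F)
  have h2 := e.orthonormal.sum_inner_products_le y (s := F)
  calc ∑ i ∈ F, ‖⟪e i, x⟫_ℂ * ⟪y, e i⟫_ℂ‖
      = ∑ i ∈ F, ‖⟪e i, x⟫_ℂ‖ * ‖⟪e i, y⟫_ℂ‖ := by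
        refine Finset.sum_congr rfl fun i _ => ?_
        rw [norm_mul, norm_inner_symm y]
    _ ≤ Real.sqrt (∑ i ∈ F, ‖⟪e i, x⟫_ℂ‖ ^ 2) * Real.sqrt (∑ i ∈ F, ‖⟪e i, y⟫_ℂ‖ ^ 2) :=
        Real.sum_mul_le_sqrt_mul_sqrt _ _ _
    _ ≤ ‖x‖ * ‖y‖ := by
        gcongr
        · exact Real.sqrt_le_iff.2 ⟨norm_nonneg _, h1⟩
        · exact Real.sqrt_le_iff.2 ⟨norm_nonneg _, h2⟩

theorem Rep.sum_int_le (h : Rep μ u v A) {ι : Type*} (e : HilbertBasis ι ℂ H) (F : Finset ι) :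
    ∑ i ∈ F, ∫ ω, ‖⟪e i, u ω⟫_ℂ * ⟪v ω, e i⟫_ℂ‖ ∂μ ≤ ∫ ω, ‖u ω‖ * ‖v ω‖ ∂μ := by
  rw [← integral_finsetSum _ fun i _ => (h.integrable _ _).norm]
  refine integral_mono (integrable_finsetSum _ fun i _ => (h.integrable _ _).norm) h.int ?_
  intro ω
  exact sum_inner_le e F (u ω) (v ω)

theorem Rep.sum_le (h : Rep μ u v A) {ι : Type*} (e : HilbertBasis ι ℂ H) (F : Finset ι) :
    ∑ i ∈ F, ‖⟪e i, A (e i)⟫_ℂ‖ ≤ ∫ ω, ‖u ω‖ * ‖v ω‖ ∂μ := by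
  refine le_trans (Finset.sum_le_sum fun i _ => ?_) (h.sum_int_le e F)
  rw [h.eq]
  exact norm_integral_le_integral_norm _

theorem Rep.hasSum (h : Rep μ u v A) {ι : Type*} (e : HilbertBasis ι ℂ H) :
    HasSum (fun i => ⟪e i, A (e i)⟫_ℂ) (∫ ω, ⟪v ω, u ω⟫_ℂ ∂μ) := by
  have := countable_of_basis e
  have key := hasSum_integral_of_summable_integral_norm
    (F := fun i ω => ⟪e i, u ω⟫_ℂ * ⟪v ω, e i⟫_ℂ) (fun i => h.integrable (e i) (e i))
    (summable_of_sum_le (fun i => integral_nonneg fun ω => norm_nonneg _) (h.sum_int_le e))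
  simp only [← h.eq] at key
  have e2 : (∫ ω, ⟪v ω, u ω⟫_ℂ ∂μ) = ∫ ω, ∑' i, ⟪e i, u ω⟫_ℂ * ⟪v ω, e i⟫_ℂ ∂μ := by
    refine integral_congr_ae (Filter.Eventually.of_forall fun ω => ?_)
    show ⟪v ω, u ω⟫_ℂ = _
    rw [← e.tsum_inner_mul_inner]
    simp only [mul_comm]
  rw [e2]; exact key

theorem Rep.trace_eq (h : Rep μ u v A) {ι : Type*} (e : HilbertBasis ι ℂ H) :
    trace e A = ∫ ω, ⟪v ω, u ω⟫_ℂ ∂μ := (h.hasSum e).tsum_eq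

end Rep

/-- Nuclear operators. -/
def IsNuc (A : H →L[ℂ] H) : Prop :=
  ∃ (Ω : Type) (_ : MeasurableSpace Ω) (μ : Measure Ω) (u v : Ω → H), SFinite μ ∧ Rep μ u v A

theorem IsNuc.left {A : H →L[ℂ] H} (h : IsNuc A) (B : H →L[ℂ] H) : IsNuc (B * A) := by
  obtain ⟨Ω, m, μ, u, v, hs, h⟩ := h
  exact ⟨Ω, m, μ, _, _, hs, h.left B⟩

theorem IsNuc.right {A : H →L[ℂ] H} (h : IsNuc A) (B : H →L[ℂ] H) : IsNuc (A * B) := by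
  obtain ⟨Ω, m, μ, u, v, hs, h⟩ := h
  exact ⟨Ω, m, μ, _, _, hs, h.right B⟩

theorem IsNuc.smul {A : H →L[ℂ] H} (h : IsNuc A) (c : ℂ) : IsNuc (c • A) := by
  have := h.left (c • 1)
  simpa using this

theorem IsNuc.neg {A : H →L[ℂ] H} (h : IsNuc A) : IsNuc (-A) := by
  simpa using h.smul (-1)

theorem IsNuc.zero : IsNuc (0 : H →L[ℂ] H) :=
  ⟨Unit, inferInstance, 0, fun _ => 0, fun _ => 0, inferInstance,
    ⟨aestronglyMeasurable_const, aestronglyMeasurable_const, by simp, by simp⟩⟩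

theorem IsNuc.add {A B : H →L[ℂ] H} (hA : IsNuc A) (hB : IsNuc B) : IsNuc (A + B) := by
  obtain ⟨Ω₁, m₁, μ₁, u₁, v₁, hs₁, h₁⟩ := hA
  obtain ⟨Ω₂, m₂, μ₂, u₂, v₂, hs₂, h₂⟩ := hB
  have E1 : MeasurableEmbedding (Sum.inl : Ω₁ → Ω₁ ⊕ Ω₂) :=
    ⟨Sum.inl_injective, measurable_inl, fun _ hs => measurableSet_inl_image.2 hs⟩
  have E2 : MeasurableEmbedding (Sum.inr : Ω₂ → Ω₁ ⊕ Ω₂) :=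
    ⟨Sum.inr_injective, measurable_inr, fun _ hs => measurableSet_inr_image.2 hs⟩
  refine ⟨Ω₁ ⊕ Ω₂, inferInstance, μ₁.map Sum.inl + μ₂.map Sum.inr, Sum.elim u₁ u₂,
    Sum.elim v₁ v₂, inferInstance, ?_, ?_, ?_, ?_⟩
  · exact ((E1.aestronglyMeasurable_map_iff (g := Sum.elim u₁ u₂)).2 h₁.hu).add_measure
      ((E2.aestronglyMeasurable_map_iff (g := Sum.elim u₁ u₂)).2 h₂.hu)
  · exact ((E1.aestronglyMeasurable_map_iff (g := Sum.elim v₁ v₂)).2 h₁.hv).add_measure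
      ((E2.aestronglyMeasurable_map_iff (g := Sum.elim v₁ v₂)).2 h₂.hv)
  · refine Integrable.add_measure ?_ ?_
    · rw [E1.integrable_map_iff]; exact h₁.int
    · rw [E2.integrable_map_iff]; exact h₂.int
  · intro x y
    rw [integral_add_measure, E1.integral_map, E2.integral_map]
    · simp only [Sum.elim_inl, Sum.elim_inr]
      rw [← h₁.eq, ← h₂.eq, add_apply, inner_add_right]
    · exact E1.integrable_map_iff.2 (h₁.integrable x y)
    · exact E2.integrable_map_iff.2 (h₂.integrable x y)

theorem IsNuc.sub {A B : H →L[ℂ] H} (hA : IsNuc A) (hB : IsNuc B) : IsNuc (A - B) := by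
  rw [sub_eq_add_neg]; exact hA.add hB.neg

theorem IsNuc.sum {κ : Type*} (s : Finset κ) {A : κ → H →L[ℂ] H} (h : ∀ i ∈ s, IsNuc (A i)) :
    IsNuc (∑ i ∈ s, A i) := by
  classical
  induction s using Finset.induction_on with
  | empty => simpa using IsNuc.zero
  | insert i s hi ih =>
    rw [Finset.sum_insert hi]
    exact (h i (by simp)).add (ih fun j hj => h j (by simp [hj]))

section trace
variable {ι : Type*} (e : HilbertBasis ι ℂ H)

theorem IsNuc.summable {A : H →L[ℂ] H} (h : IsNuc A) :
    Summable fun i => ⟪e i, A (e i)⟫_ℂ := by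
  obtain ⟨Ω, m, μ, u, v, hs, h⟩ := h
  exact (h.hasSum e).summable

theorem tr_add {A B : H →L[ℂ] H} (hA : IsNuc A) (hB : IsNuc B) :
    trace e (A + B) = trace e A + trace e B := by
  simp only [trace, add_apply, inner_add_right]
  exact (hA.summable e).tsum_add (hB.summable e)

theorem tr_sub {A B : H →L[ℂ] H} (hA : IsNuc A) (hB : IsNuc B) :
    trace e (A - B) = trace e A - trace e B := by
  simp only [trace, sub_apply, inner_sub_right]
  exact (hA.summable e).tsum_sub (hB.summable e)

theorem tr_smul (c : ℂ) (A : H →L[ℂ] H) : trace e (c • A) = c * trace e A := by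
  simp only [trace, smul_apply, inner_smul_right]
  exact tsum_mul_left

theorem tr_zero : trace e (0 : H →L[ℂ] H) = 0 := by simp [trace]

theorem tr_sum {κ : Type*} (s : Finset κ) {A : κ → H →L[ℂ] H} (h : ∀ i ∈ s, IsNuc (A i)) :
    trace e (∑ i ∈ s, A i) = ∑ i ∈ s, trace e (A i) := by
  classical
  induction s using Finset.induction_on with
  | empty => simp [tr_zero]
  | insert i s hi ih =>
    have h' : ∀ j ∈ s, IsNuc (A j) := fun j hj => h j (by simp [hj])
    rw [Finset.sum_insert hi, Finset.sum_insert hi, tr_add e (h i (by simp)) (IsNuc.sum s h'), ih h']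

theorem tr_comm {A : H →L[ℂ] H} (h : IsNuc A) (B : H →L[ℂ] H) :
    trace e (A * B) = trace e (B * A) := by
  obtain ⟨Ω, m, μ, u, v, hs, h⟩ := h
  rw [(h.right B).trace_eq e, (h.left B).trace_eq e]
  simp only [ContinuousLinearMap.adjoint_inner_left]

end trace

/-! ### Trace norm -/

theorem rep_of_sqrt {ι : Type*} (e : HilbertBasis ι ℂ H) {S : H →L[ℂ] H} (hS : IsSelfAdjoint S)
    (hsum : Summable fun i => ‖S (e i)‖ ^ 2) :
    ∃ (Ω : Type) (_ : MeasurableSpace Ω) (μ : Measure Ω) (u : Ω → H), SFinite μ ∧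
      Rep μ u u (S * S) ∧ ∫ ω, ‖u ω‖ * ‖u ω‖ ∂μ = ∑' i, ‖S (e i)‖ ^ 2 := by
  have hc := countable_of_basis e
  have hS' := ContinuousLinearMap.isSelfAdjoint_iff'.1 hS
  let m : MeasurableSpace (Shrink.{0} ι) := ⊤
  have hm : DiscreteMeasurableSpace (Shrink.{0} ι) := ⟨fun _ => trivial⟩
  have hcs : Countable (Shrink.{0} ι) := (equivShrink.{0} ι).symm.injective.countable
  let u : Shrink.{0} ι → H := fun j => S (e ((equivShrink.{0} ι).symm j))
  have hsum' : Summable fun j => ‖u j‖ * ‖u j‖ := by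
    have := ((equivShrink.{0} ι).symm.summable_iff (f := fun i => ‖S (e i)‖ ^ 2)).2 hsum
    refine this.congr fun j => ?_
    simp [u, sq]
  have huint : Integrable (fun j => ‖u j‖ * ‖u j‖) Measure.count := by
    rw [integrable_count_iff]
    exact hsum'.norm
  have hrep : Rep Measure.count u u (S * S) := by
    refine ⟨StronglyMeasurable.of_discrete.aestronglyMeasurable,
      StronglyMeasurable.of_discrete.aestronglyMeasurable, huint, ?_⟩
    intro x y
    have hi : Integrable (fun j => ⟪x, u j⟫_ℂ * ⟪u j, y⟫_ℂ) Measure.count := by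
      refine (huint.const_mul (‖x‖ * ‖y‖)).mono'
        StronglyMeasurable.of_discrete.aestronglyMeasurable ?_
      refine Filter.Eventually.of_forall fun ω => ?_
      rw [norm_mul]
      calc ‖⟪x, u ω⟫_ℂ‖ * ‖⟪u ω, y⟫_ℂ‖ ≤ (‖x‖ * ‖u ω‖) * (‖u ω‖ * ‖y‖) := by
            gcongr <;> exact norm_inner_le_norm _ _
        _ = _ := by ring
    rw [integral_countable hi]
    simp only [Measure.real, Measure.count_singleton, ENNReal.toReal_one, one_smul]
    rw [(equivShrink.{0} ι).symm.tsum_eq (fun i => ⟪x, S (e i)⟫_ℂ * ⟪S (e i), y⟫_ℂ),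
      mul_apply_eq_comp, ← ContinuousLinearMap.adjoint_inner_left, hS', ← e.tsum_inner_mul_inner]
    refine tsum_congr fun i => ?_
    rw [← ContinuousLinearMap.adjoint_inner_left S, ← ContinuousLinearMap.adjoint_inner_left S, hS']
  refine ⟨Shrink.{0} ι, m, Measure.count, u, inferInstance, hrep, ?_⟩
  rw [integral_countable huint]
  simp only [Measure.real, Measure.count_singleton, ENNReal.toReal_one, one_smul]
  rw [← (equivShrink.{0} ι).symm.tsum_eq (fun i => ‖S (e i)‖ ^ 2)]
  exact tsum_congr fun j => (sq _).symm

theorem exists_sqrt {P : H →L[ℂ] H} (hP : 0 ≤ P) :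
    ∃ S : H →L[ℂ] H, IsSelfAdjoint S ∧ S * S = P ∧ ∀ x, ‖S x‖ ^ 2 = (⟪x, P x⟫_ℂ).re := by
  refine ⟨CFC.sqrt P, (CFC.sqrt_nonneg P).isSelfAdjoint, CFC.sqrt_mul_sqrt_self P hP, ?_⟩
  intro x
  have hS := ContinuousLinearMap.isSelfAdjoint_iff'.1 (CFC.sqrt_nonneg P).isSelfAdjoint
  conv_rhs => rw [← CFC.sqrt_mul_sqrt_self P hP]
  rw [mul_apply_eq_comp, ← ContinuousLinearMap.adjoint_inner_left, hS]
  exact (@inner_self_eq_norm_sq ℂ _ _ _ _ _).symm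

section polar
variable (A : H →L[ℂ] H)

theorem adj_mul_nonneg : 0 ≤ ContinuousLinearMap.adjoint A * A := star_mul_self_nonneg A

theorem absOp_nonneg : 0 ≤ absOp A := cfc_nonneg fun x _ => Real.sqrt_nonneg x

theorem absOp_mul_self : absOp A * absOp A = ContinuousLinearMap.adjoint A * A := by
  have h0 := adj_mul_nonneg A
  have hsa : IsSelfAdjoint (ContinuousLinearMap.adjoint A * A) := h0.isSelfAdjoint
  rw [absOp, ← cfc_mul _ _ _ (by fun_prop) (by fun_prop)]
  conv_rhs => rw [← cfc_id ℝ (ContinuousLinearMap.adjoint A * A)]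
  refine cfc_congr fun s hs => ?_
  exact Real.mul_self_sqrt (spectrum_nonneg_of_nonneg h0 hs)

theorem polar_approx {ε : ℝ} (hε : 0 < ε) : ∃ W : H →L[ℂ] H, ‖W‖ ≤ 1 ∧
    ‖absOp A - ContinuousLinearMap.adjoint W * A‖ ≤ ε ∧ ‖A - W * absOp A‖ ≤ ε := by
  have hP := absOp_nonneg A
  have hPP := absOp_mul_self A
  set P := absOp A with hPdef
  have hsa : IsSelfAdjoint P := hP.isSelfAdjoint
  have hpos : ∀ s ∈ spectrum ℝ P, 0 ≤ s := fun s hs => spectrum_nonneg_of_nonneg hP hs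
  have hcR : ContinuousOn (fun s : ℝ => (s + ε)⁻¹) (spectrum ℝ P) :=
    ContinuousOn.inv₀ (by fun_prop) fun s hs => by have := hpos s hs; positivity
  have hcI : ContinuousOn (fun s : ℝ => s) (spectrum ℝ P) := by fun_prop
  have hcRI : ContinuousOn (fun s : ℝ => (s + ε)⁻¹ * s) (spectrum ℝ P) := hcR.mul hcI
  have hcRII : ContinuousOn (fun s : ℝ => (s + ε)⁻¹ * s * s) (spectrum ℝ P) := hcRI.mul hcI
  set R := cfc (fun s : ℝ => (s + ε)⁻¹) P with hR
  have hRsa : IsSelfAdjoint R := IsSelfAdjoint.cfc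
  have hRad : ContinuousLinearMap.adjoint R = R := ContinuousLinearMap.isSelfAdjoint_iff'.1 hRsa
  have hPid : cfc (fun s : ℝ => s) P = P := cfc_id' ℝ P
  have hPR : P * R = cfc (fun s : ℝ => s * (s + ε)⁻¹) P := by
    rw [cfc_mul _ _ P hcI hcR, hPid]
  have hRP : R * P = cfc (fun s : ℝ => (s + ε)⁻¹ * s) P := by
    rw [cfc_mul _ _ P hcR hcI, hPid]
  have hW : ‖A * R‖ ≤ 1 := by
    have h1 : ‖P * R‖ ≤ 1 := by
      rw [hPR]
      refine norm_cfc_le zero_le_one fun s hs => ?_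
      have := hpos s hs
      rw [Real.norm_of_nonneg (by positivity), ← div_eq_mul_inv, div_le_one (by positivity)]
      linarith
    refine ContinuousLinearMap.opNorm_le_bound _ zero_le_one fun x => ?_
    have h2 : ‖(A * R) x‖ = ‖(P * R) x‖ := by
      have : ‖A (R x)‖ ^ 2 = ‖P (R x)‖ ^ 2 := by
        rw [← @inner_self_eq_norm_sq ℂ, ← @inner_self_eq_norm_sq ℂ,
          ← ContinuousLinearMap.adjoint_inner_right, ← ContinuousLinearMap.adjoint_inner_right P,
          ContinuousLinearMap.isSelfAdjoint_iff'.1 hsa, ← mul_apply_eq_comp, ← hPP,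
          mul_apply_eq_comp]
      exact (sq_eq_sq₀ (norm_nonneg _) (norm_nonneg _)).1 this
    rw [h2]
    exact (P * R).le_of_opNorm_le h1 x
  refine ⟨A * R, hW, ?_, ?_⟩
  · have h1 : ContinuousLinearMap.adjoint (A * R) * A = R * P * P := by
      have : ContinuousLinearMap.adjoint (A * R) =
        ContinuousLinearMap.adjoint R * ContinuousLinearMap.adjoint A := star_mul A R
      rw [this, hRad, mul_assoc, ← hPP, mul_assoc]
    have h2 : P - R * P * P = cfc (fun s : ℝ => s - (s + ε)⁻¹ * s * s) P := by
      rw [cfc_sub (fun s : ℝ => s) _ P hcI hcRII,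
        cfc_mul _ _ P hcRI hcI, ← hRP, hPid]
    rw [h1, h2]
    refine norm_cfc_le hε.le fun s hs => ?_
    have := hpos s hs
    have e1 : s - (s + ε)⁻¹ * s * s = ε * (s / (s + ε)) := by field_simp; ring
    rw [e1, Real.norm_of_nonneg (by positivity)]
    have : s / (s + ε) ≤ 1 := by rw [div_le_one (by positivity)]; linarith
    nlinarith
  · have h2 : 1 - R * P = ε • R := by
      rw [hRP, hR, ← cfc_const_one ℝ P, ← cfc_sub _ _ P continuousOn_const hcRI,
        ← cfc_smul ε _ P hcR]
      refine cfc_congr fun s hs => ?_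
      have := hpos s hs
      simp only [smul_eq_mul]
      field_simp; ring
    have h3 : A - A * R * P = ε • (A * R) := by
      rw [← mul_smul_comm, ← h2]; noncomm_ring
    rw [h3, norm_smul, Real.norm_of_nonneg hε.le]
    nlinarith

end polar

theorem IsNuc.traceClass {A : H →L[ℂ] H} (h : IsNuc A) {ι : Type*} (e : HilbertBasis ι ℂ H) :
    IsTraceClass e A := by
  obtain ⟨Ω, m, μ, u, v, hs, h⟩ := h
  have hnn : ∀ x, 0 ≤ (⟪x, absOp A x⟫_ℂ).re := fun x =>
    ((ContinuousLinearMap.nonneg_iff_isPositive _).1 (absOp_nonneg A)).re_inner_nonneg_right x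
  refine summable_of_sum_le (c := ∫ ω, ‖u ω‖ * ‖v ω‖ ∂μ) (fun i => hnn _) fun F => ?_
  refine le_of_forall_pos_le_add fun δ hδ => ?_
  obtain ⟨W, hW, h1, -⟩ := polar_approx A (ε := δ / (F.card + 1)) (by positivity)
  have hW' : ‖ContinuousLinearMap.adjoint W‖ ≤ 1 := by
    rwa [LinearIsometryEquiv.norm_map]
  have hr := h.left (ContinuousLinearMap.adjoint W)
  calc ∑ i ∈ F, (⟪e i, absOp A (e i)⟫_ℂ).re
      ≤ ∑ i ∈ F, (‖⟪e i, (ContinuousLinearMap.adjoint W * A) (e i)⟫_ℂ‖ + δ / (F.card + 1)) := by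
        refine Finset.sum_le_sum fun i _ => ?_
        have e1 : ⟪e i, absOp A (e i)⟫_ℂ = ⟪e i, (ContinuousLinearMap.adjoint W * A) (e i)⟫_ℂ +
            ⟪e i, (absOp A - ContinuousLinearMap.adjoint W * A) (e i)⟫_ℂ := by
          rw [← inner_add_right, sub_apply]; simp
        rw [e1, Complex.add_re]
        refine add_le_add (Complex.re_le_norm _) ((Complex.re_le_norm _).trans ?_)
        refine (norm_inner_le_norm _ _).trans ?_
        rw [e.orthonormal.1 i, one_mul]
        refine (ContinuousLinearMap.le_of_opNorm_le _ h1 _).trans ?_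
        rw [e.orthonormal.1 i, mul_one]
    _ ≤ ∫ ω, ‖u ω‖ * ‖v ω‖ ∂μ + δ := by
        rw [Finset.sum_add_distrib]
        refine add_le_add ((hr.sum_le e F).trans ?_) ?_
        · refine integral_mono hr.int h.int fun ω => ?_
          show _ * _ ≤ _ * _
          gcongr
          refine (ContinuousLinearMap.le_of_opNorm_le _ hW' _).trans (by rw [one_mul])
        · rw [Finset.sum_const, nsmul_eq_mul, mul_div_assoc']
          rw [div_le_iff₀ (by positivity)]
          nlinarith

theorem sum_le_traceNorm {A : H →L[ℂ] H} {ι : Type*} (e : HilbertBasis ι ℂ H)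
    (h : IsTraceClass e A) (B : H →L[ℂ] H) (F : Finset ι) :
    ∑ i ∈ F, ‖⟪e i, (B * A) (e i)⟫_ℂ‖ ≤ ‖B‖ * traceNorm e A := by
  obtain ⟨S, hS, hSS, hn⟩ := exists_sqrt (absOp_nonneg A)
  have hsum : Summable fun i => ‖S (e i)‖ ^ 2 := by simp only [hn]; exact h
  obtain ⟨Ω, m, μ, u, hs, hr, hI⟩ := rep_of_sqrt e hS hsum
  rw [hSS] at hr
  have hI' : ∫ ω, ‖u ω‖ * ‖u ω‖ ∂μ = traceNorm e A := by
    rw [hI, traceNorm]; simp only [hn]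
  refine le_of_forall_pos_le_add fun δ hδ => ?_
  obtain ⟨W, hW, -, h1⟩ := polar_approx A (ε := δ / ((F.card + 1) * (‖B‖ + 1))) (by positivity)
  have hr' := hr.left (B * W)
  have hBW : ‖B * W‖ ≤ ‖B‖ := by
    refine (norm_mul_le _ _).trans ?_
    nlinarith [norm_nonneg B]
  calc ∑ i ∈ F, ‖⟪e i, (B * A) (e i)⟫_ℂ‖
      ≤ ∑ i ∈ F, (‖⟪e i, (B * W * absOp A) (e i)⟫_ℂ‖ + δ / (F.card + 1)) := by
        refine Finset.sum_le_sum fun i _ => ?_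
        have e1 : ⟪e i, (B * A) (e i)⟫_ℂ = ⟪e i, (B * W * absOp A) (e i)⟫_ℂ +
            ⟪e i, (B * (A - W * absOp A)) (e i)⟫_ℂ := by
          rw [← inner_add_right, ← add_apply]; congr 3; noncomm_ring
        rw [e1]
        refine (norm_add_le _ _).trans (add_le_add le_rfl ?_)
        refine (norm_inner_le_norm _ _).trans ?_
        rw [e.orthonormal.1 i, one_mul]
        refine (ContinuousLinearMap.le_opNorm _ _).trans ?_
        rw [e.orthonormal.1 i, mul_one]
        refine (norm_mul_le _ _).trans ?_
        calc ‖B‖ * ‖A - W * absOp A‖ ≤ (‖B‖ + 1) * (δ / ((F.card + 1) * (‖B‖ + 1))) := by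
              gcongr; linarith
          _ = _ := by field_simp
    _ ≤ ‖B‖ * traceNorm e A + δ := by
        rw [Finset.sum_add_distrib]
        refine add_le_add ((hr'.sum_le e F).trans ?_) ?_
        · rw [← hI', ← integral_const_mul]
          refine integral_mono hr'.int (hr.int.const_mul _) fun ω => ?_
          show _ * _ ≤ _ * (_ * _)
          rw [← mul_assoc]
          gcongr
          exact ContinuousLinearMap.le_of_opNorm_le _ hBW _
        · rw [Finset.sum_const, nsmul_eq_mul, mul_div_assoc', div_le_iff₀ (by positivity)]
          nlinarith

theorem norm_trace_le {A : H →L[ℂ] H} {ι : Type*} (e : HilbertBasis ι ℂ H)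
    (h : IsNuc A) (B : H →L[ℂ] H) :
    ‖trace e (B * A)‖ ≤ ‖B‖ * traceNorm e A := by
  refine le_of_tendsto ((h.left B).summable e).hasSum.norm (Filter.Eventually.of_forall fun F => ?_)
  exact (norm_sum_le _ _).trans (sum_le_traceNorm e (h.traceClass e) B F)

/-! ### Commutators with functions of an operator -/

section comm
variable {ι : Type*} (e : HilbertBasis ι ℂ H) {A B : H →L[ℂ] H}

theorem comm_pow (hM : IsNuc (B * A - A * B)) (n : ℕ) :
    IsNuc (B * A ^ n - A ^ n * B) ∧ ∀ C : H →L[ℂ] H, Commute C A →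
      trace e (C * (B * A ^ n - A ^ n * B)) = n * trace e (C * A ^ (n - 1) * (B * A - A * B)) := by
  induction n with
  | zero =>
    simp only [pow_zero, mul_one, one_mul, sub_self, mul_zero, tr_zero, Nat.cast_zero, zero_mul,
      implies_true, and_true]
    exact IsNuc.zero
  | succ n ih =>
    obtain ⟨h1, h2⟩ := ih
    have e1 : B * A ^ (n + 1) - A ^ (n + 1) * B =
        (B * A ^ n - A ^ n * B) * A + A ^ n * (B * A - A * B) := by
      rw [pow_succ]; noncomm_ring
    refine ⟨by rw [e1]; exact (h1.right A).add (hM.left _), fun C hC => ?_⟩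
    rw [e1, mul_add, tr_add e ((h1.right A).left C) ((hM.left _).left C), ← mul_assoc,
      tr_comm e (h1.left C), ← mul_assoc A C, h2 (A * C) ((Commute.refl A).mul_left hC)]
    have e2 : (n : ℂ) * trace e (A * C * A ^ (n - 1) * (B * A - A * B)) =
        n * trace e (C * A ^ n * (B * A - A * B)) := by
      cases n with
      | zero => simp
      | succ k => rw [← hC.eq, mul_assoc C A, Nat.add_sub_cancel, ← pow_succ']
    rw [e2, ← mul_assoc]
    rw [Nat.add_sub_cancel]
    push_cast
    ring

theorem comm_poly (hM : IsNuc (B * A - A * B)) (p : ℂ[X]) :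
    IsNuc (B * aeval A p - aeval A p * B) ∧
      trace e (B * aeval A p - aeval A p * B) =
        trace e (aeval A (derivative p) * (B * A - A * B)) := by
  induction p using Polynomial.induction_on' with
  | add p q hp hq =>
    have e1 : B * aeval A (p + q) - aeval A (p + q) * B =
        (B * aeval A p - aeval A p * B) + (B * aeval A q - aeval A q * B) := by
      rw [map_add]; noncomm_ring
    rw [e1]
    refine ⟨hp.1.add hq.1, ?_⟩
    rw [tr_add e hp.1 hq.1, hp.2, hq.2, derivative_add, map_add, add_mul,
      tr_add e (hM.left _) (hM.left _)]
  | monomial n c =>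
    obtain ⟨h1, h2⟩ := comm_pow e hM n
    have e1 : B * aeval A (monomial n c) - aeval A (monomial n c) * B =
        c • (B * A ^ n - A ^ n * B) := by
      rw [aeval_monomial, Algebra.algebraMap_eq_smul_one]
      simp [smul_sub]
    rw [e1]
    refine ⟨h1.smul c, ?_⟩
    have h3 := h2 1 (Commute.one_left A)
    simp only [one_mul] at h3
    rw [tr_smul, h3, derivative_monomial, aeval_monomial, Algebra.algebraMap_eq_smul_one,
      smul_mul_assoc, one_mul, smul_mul_assoc, tr_smul, mul_assoc]

/-- The unitary group `e^{iαA}`. -/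
noncomputable def Eop (A : H →L[ℂ] H) (α : ℝ) : H →L[ℂ] H :=
  fc (fun t => Complex.exp (Complex.I * (α : ℂ) * (t : ℂ))) A

theorem Eop_eq_exp (hA : IsSelfAdjoint A) (α : ℝ) :
    Eop A α = NormedSpace.exp (α • (Complex.I • A)) := by
  have := hA.isStarNormal
  have h1 : α • (Complex.I • A) = (Complex.I * α) • A := by
    rw [mul_comm, mul_smul]; rfl
  have h2 : IsStarNormal ((Complex.I * α) • A) := inferInstance
  rw [h1, ← CFC.complex_exp_eq_normedSpace_exp,
    ← cfc_comp_smul (Complex.I * α) Complex.exp A]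
  refine cfc_congr fun z hz => ?_
  simp only [(spec_re hA hz).2, smul_eq_mul]

theorem Eop_norm (hA : IsSelfAdjoint A) (α : ℝ) : ‖Eop A α‖ ≤ 1 := by
  refine norm_cfc_le zero_le_one fun z hz => ?_
  show ‖Complex.exp (Complex.I * (α : ℂ) * ((z.re : ℝ) : ℂ))‖ ≤ 1
  rw [mul_assoc, ← Complex.ofReal_mul, mul_comm, Complex.norm_exp_ofReal_mul_I]

theorem Eop_mul (α β : ℝ) : Eop A α * Eop A β = Eop A (α + β) := by
  rw [Eop, Eop, Eop, ← fc_mul (by fun_prop) (by fun_prop)]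
  congr 1; ext t
  rw [← Complex.exp_add]; congr 1; push_cast; ring

theorem Eop_adj (α : ℝ) : ContinuousLinearMap.adjoint (Eop A α) = Eop A (-α) := by
  rw [Eop, fc_adjoint, Eop]
  congr 1; ext t
  rw [Complex.star_def, ← Complex.exp_conj]
  simp

theorem Eop_zero (hA : IsSelfAdjoint A) : Eop A 0 = 1 := by
  rw [Eop_eq_exp hA]; simp

theorem Eop_commute (hA : IsSelfAdjoint A) (α : ℝ) : Commute (Eop A α) A := by
  have := fc_comm (A := A) (fun t => Complex.exp (Complex.I * (α : ℂ) * (t : ℂ)))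
    (fun t => (t : ℂ))
  rwa [fc_id hA] at this

theorem Eop_deriv (hA : IsSelfAdjoint A) (α : ℝ) :
    HasDerivAt (Eop A) (Eop A α * (Complex.I • A)) α := by
  have h := hasDerivAt_exp_smul_const (𝕂 := ℝ) (Complex.I • A) α
  have h1 : (fun α : ℝ => NormedSpace.exp (α • (Complex.I • A))) = Eop A := by
    ext1 α; exact (Eop_eq_exp hA α).symm
  rwa [h1, ← Eop_eq_exp hA] at h

theorem Eop_cont (hA : IsSelfAdjoint A) : Continuous (Eop A) :=
  continuous_iff_continuousAt.2 fun α => (Eop_deriv hA α).continuousAt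

theorem fc_fourier (hA : IsSelfAdjoint A) {g : ℝ → ℂ} (hg : Integrable g) :
    Integrable (fun α => g α • Eop A α) ∧
    fc (fun β => ∫ α : ℝ, Complex.exp (Complex.I * (α : ℂ) * (β : ℂ)) * g α) A =
      ∫ α, g α • Eop A α := by
  have hn := hA.isStarNormal
  have hi : Integrable (fun α => g α • Eop A α) := by
    refine hg.norm.mono' (hg.1.smul (Eop_cont hA).aestronglyMeasurable) ?_
    refine Filter.Eventually.of_forall fun α => ?_
    rw [norm_smul]
    nlinarith [Eop_norm hA α, norm_nonneg (g α)]
  refine ⟨hi, ?_⟩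
  let cm : C(ℝ × spectrum ℂ A, ℂ) :=
    ⟨fun p => Complex.exp (Complex.I * (p.1 : ℂ) * ((p.2 : ℂ).re : ℂ)), by fun_prop⟩
  let c : C(ℝ, C(spectrum ℂ A, ℂ)) := cm.curry
  have hc : ∀ α, ‖c α‖ ≤ 1 := by
    intro α
    refine (ContinuousMap.norm_le _ zero_le_one).2 fun z => ?_
    show ‖Complex.exp (Complex.I * (α : ℂ) * ((z : ℂ).re : ℂ))‖ ≤ 1
    rw [mul_assoc, ← Complex.ofReal_mul, mul_comm, Complex.norm_exp_ofReal_mul_I]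
  have hci : Integrable (fun α => g α • c α) := by
    refine hg.norm.mono' (hg.1.smul c.continuous.aestronglyMeasurable) ?_
    refine Filter.Eventually.of_forall fun α => ?_
    rw [norm_smul]
    nlinarith [hc α, norm_nonneg (g α)]
  have hE : ∀ α, Eop A α = cfcHom hn (c α) := by
    intro α
    rw [Eop, fc, cfc_apply _ A hn (by fun_prop)]
    rfl
  have h2 := cfcHom_integral A _ hci hn
  simp only [map_smul, ← hE] at h2
  rw [h2]
  have h3 : ∀ z : spectrum ℂ A, (∫ α, g α • c α) z =
      ∫ α : ℝ, Complex.exp (Complex.I * (α : ℂ) * ((z : ℂ).re : ℂ)) * g α := by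
    intro z
    have := (ContinuousMap.evalCLM ℂ z).integral_comp_comm hci
    have e2 : (∫ α, g α • c α) z = (ContinuousMap.evalCLM ℂ z) (∫ α, g α • c α) := rfl
    rw [e2, ← this]
    refine integral_congr_ae (Filter.Eventually.of_forall fun α => ?_)
    show g α * _ = _
    rw [mul_comm]; rfl
  have hcont : ContinuousOn (fun z : ℂ => ∫ α : ℝ,
      Complex.exp (Complex.I * (α : ℂ) * (z.re : ℂ)) * g α) (spectrum ℂ A) := by
    rw [continuousOn_iff_continuous_domRestrict]
    refine (ContinuousMap.continuous (∫ α, g α • c α)).congr fun z => ?_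
    exact h3 z
  rw [fc, cfc_apply _ A hn hcont]
  congr 1
  ext z
  exact (h3 z).symm

theorem comm_Eop (hA : IsSelfAdjoint A) (α : ℝ) :
    B * Eop A α - Eop A α * B = ∫ r in (0 : ℝ)..1,
      (Complex.I * α) • (Eop A (r * α) * (B * A - A * B) * Eop A ((1 - r) * α)) := by
  have hd : ∀ r : ℝ, HasDerivAt (fun r => - (Eop A (r * α) * B * Eop A ((1 - r) * α)))
      ((Complex.I * α) • (Eop A (r * α) * (B * A - A * B) * Eop A ((1 - r) * α))) r := by
    intro r
    have h1 : HasDerivAt (fun r => Eop A (r * α)) (α • (Eop A (r * α) * (Complex.I • A))) r :=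
      HasDerivAt.scomp (h := fun r : ℝ => r * α) (g₁ := Eop A) r (Eop_deriv hA (r * α))
        (hasDerivAt_mul_const α)
    have h2 : HasDerivAt (fun r => Eop A ((1 - r) * α))
        ((-1 * α) • (Eop A ((1 - r) * α) * (Complex.I • A))) r :=
      HasDerivAt.scomp (h := fun r : ℝ => (1 - r) * α) (g₁ := Eop A) r
        (Eop_deriv hA ((1 - r) * α)) (((hasDerivAt_id' r).const_sub 1).mul_const α)
    have h3 := ((h1.mul_const B).mul h2).neg
    refine h3.congr_deriv ?_
    have hc : Eop A ((1 - r) * α) * A = A * Eop A ((1 - r) * α) := (Eop_commute hA _).eq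
    have e1 : ∀ Z : H →L[ℂ] H, α • Z = (α : ℂ) • Z := fun Z => rfl
    have e2 : ∀ Z : H →L[ℂ] H, (-1 * α) • Z = -((α : ℂ) • Z) := fun Z => by
      rw [neg_one_mul, neg_smul]; rfl
    rw [e1, e2, mul_smul_comm, mul_smul_comm, hc]
    simp only [smul_mul_assoc, mul_smul_comm, mul_neg, mul_sub, sub_mul, smul_sub, smul_smul,
      mul_comm (α : ℂ) Complex.I, mul_assoc]
    abel
  rw [intervalIntegral.integral_eq_sub_of_hasDerivAt (fun r _ => hd r)]
  · simp [Eop_zero hA]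
    abel
  · have := Eop_cont hA
    exact Continuous.intervalIntegrable (by fun_prop) _ _

end comm

/-! ### Commutators with functions in `C¹₁` -/

section commC
variable {ι : Type*} (e : HilbertBasis ι ℂ H) {A B : H →L[ℂ] H}

theorem rep_integral {Ω S : Type} [MeasurableSpace Ω] [MeasurableSpace S] {μ : Measure Ω}
    {ν : Measure S} [SFinite μ] [SFinite ν] {u v : Ω → H} {M : H →L[ℂ] H} (hM : Rep μ u v M)
    {L R : S → H →L[ℂ] H} (hL : AEStronglyMeasurable L ν) (hR : AEStronglyMeasurable R ν)
    (hL1 : ∀ s, ‖L s‖ ≤ 1) (hR1 : ∀ s, ‖R s‖ ≤ 1) {k : S → ℂ} (hk : Integrable k ν)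
    {Z : H →L[ℂ] H} (hZ : ∀ x y, ⟪x, Z y⟫_ℂ = ∫ s, k s * ⟪x, (L s * M * R s) y⟫_ℂ ∂ν) :
    IsNuc Z ∧ trace e Z = ∫ s, k s * trace e (L s * M * R s) ∂ν := by
  have hR' : AEStronglyMeasurable (fun s => ContinuousLinearMap.adjoint (R s)) ν :=
    (ContinuousLinearMap.adjoint (𝕜 := ℂ) (E := H) (F := H)).continuous.comp_aestronglyMeasurable hR
  have hR1' : ∀ s, ‖ContinuousLinearMap.adjoint (R s)‖ ≤ 1 := fun s => by
    rw [LinearIsometryEquiv.norm_map]; exact hR1 s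
  have hap : Continuous (fun p : (H →L[ℂ] H) × H => p.1 p.2) := isBoundedBilinearMap_apply.continuous
  have hu : AEStronglyMeasurable (fun q : Ω × S => L q.2 (u q.1)) (μ.prod ν) :=
    hap.comp_aestronglyMeasurable₂ hL.comp_snd hM.hu.comp_fst
  have hv : AEStronglyMeasurable (fun q : Ω × S => ContinuousLinearMap.adjoint (R q.2) (v q.1))
      (μ.prod ν) :=
    hap.comp_aestronglyMeasurable₂ hR'.comp_snd hM.hv.comp_fst
  have hku : AEStronglyMeasurable (fun q : Ω × S => k q.2 • L q.2 (u q.1)) (μ.prod ν) :=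
    hk.1.comp_snd.smul hu
  have huint : Integrable (fun q : Ω × S => (‖u q.1‖ * ‖v q.1‖) * ‖k q.2‖) (μ.prod ν) :=
    hM.int.mul_prod hk.norm
  have hrep : Rep (μ.prod ν) (fun q : Ω × S => k q.2 • L q.2 (u q.1))
      (fun q : Ω × S => ContinuousLinearMap.adjoint (R q.2) (v q.1)) Z := by
    have hi : Integrable (fun q : Ω × S => ‖k q.2 • L q.2 (u q.1)‖ *
        ‖ContinuousLinearMap.adjoint (R q.2) (v q.1)‖) (μ.prod ν) := by
      refine huint.mono' (hku.norm.mul hv.norm) (Filter.Eventually.of_forall fun q => ?_)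
      rw [Real.norm_of_nonneg (by positivity), norm_smul]
      have h1 : ‖L q.2 (u q.1)‖ ≤ ‖u q.1‖ :=
        ((L q.2).le_of_opNorm_le (hL1 _) _).trans (by rw [one_mul])
      have h2 : ‖ContinuousLinearMap.adjoint (R q.2) (v q.1)‖ ≤ ‖v q.1‖ :=
        (ContinuousLinearMap.le_of_opNorm_le _ (hR1' _) _).trans (by rw [one_mul])
      calc _ ≤ ‖k q.2‖ * ‖u q.1‖ * ‖v q.1‖ := by gcongr
        _ = _ := by ring
    refine ⟨hku, hv, hi, fun x y => ?_⟩
    have hxy : Integrable (fun q : Ω × S => ⟪x, k q.2 • L q.2 (u q.1)⟫_ℂ *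
        ⟪ContinuousLinearMap.adjoint (R q.2) (v q.1), y⟫_ℂ) (μ.prod ν) := by
      refine (hi.const_mul (‖x‖ * ‖y‖)).mono'
        ((aestronglyMeasurable_const.inner hku).mul (hv.inner aestronglyMeasurable_const)) ?_
      refine Filter.Eventually.of_forall fun q => ?_
      rw [norm_mul]
      calc _ ≤ (‖x‖ * ‖k q.2 • L q.2 (u q.1)‖) *
          (‖ContinuousLinearMap.adjoint (R q.2) (v q.1)‖ * ‖y‖) := by
            gcongr <;> exact norm_inner_le_norm _ _
        _ = _ := by ring
    rw [hZ, integral_prod_symm _ hxy]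
    refine integral_congr_ae (Filter.Eventually.of_forall fun s => ?_)
    show k s * _ = _
    rw [((hM.left (L s)).right (R s)).eq, ← integral_const_mul]
    refine integral_congr_ae (Filter.Eventually.of_forall fun ω => ?_)
    simp only [inner_smul_right, mul_assoc]
  refine ⟨⟨Ω × S, inferInstance, μ.prod ν, _, _, inferInstance, hrep⟩, ?_⟩
  rw [hrep.trace_eq e]
  have hi2 : Integrable (fun q : Ω × S => ⟪ContinuousLinearMap.adjoint (R q.2) (v q.1),
      k q.2 • L q.2 (u q.1)⟫_ℂ) (μ.prod ν) := by
    refine hrep.int.mono' (hv.inner hku) (Filter.Eventually.of_forall fun q => ?_)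
    rw [mul_comm]; exact norm_inner_le_norm _ _
  rw [integral_prod_symm _ hi2]
  refine integral_congr_ae (Filter.Eventually.of_forall fun s => ?_)
  show _ = k s * _
  rw [((hM.left (L s)).right (R s)).trace_eq e, ← integral_const_mul]
  refine integral_congr_ae (Filter.Eventually.of_forall fun ω => ?_)
  simp only [inner_smul_right]

theorem inner_integral_apply {S : Type*} [MeasurableSpace S] {ν : Measure S} {F : S → H →L[ℂ] H}
    (hF : Integrable F ν) (x y : H) : ⟪x, (∫ s, F s ∂ν) y⟫_ℂ = ∫ s, ⟪x, F s y⟫_ℂ ∂ν := by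
  rw [ContinuousLinearMap.integral_apply hF,
    integral_inner (hF.apply_continuousLinearMap y)]

theorem fourier_cont {g : ℝ → ℂ} (hg : Integrable g) :
    Continuous (fun β : ℝ => ∫ α : ℝ, Complex.exp (Complex.I * (α : ℂ) * (β : ℂ)) * g α) := by
  refine continuous_of_dominated (bound := fun α => ‖g α‖) (fun β => ?_) (fun β => ?_) hg.norm ?_
  · exact (Continuous.aestronglyMeasurable (by fun_prop)).mul hg.1
  · refine Filter.Eventually.of_forall fun α => ?_
    rw [norm_mul, mul_assoc, ← Complex.ofReal_mul, mul_comm Complex.I,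
      Complex.norm_exp_ofReal_mul_I, one_mul]
  · exact Filter.Eventually.of_forall fun α => by fun_prop

theorem fourier_deriv {g : ℝ → ℂ} (hg : Integrable g) (hg1 : Integrable (fun α : ℝ => α • g α))
    (β : ℝ) :
    HasDerivAt (fun β : ℝ => ∫ α : ℝ, Complex.exp (Complex.I * (α : ℂ) * (β : ℂ)) * g α)
      (∫ α : ℝ, Complex.exp (Complex.I * (α : ℂ) * (β : ℂ)) * (Complex.I * (α • g α))) β := by
  refine (hasDerivAt_integral_of_dominated_loc_of_deriv_le (bound := fun α => ‖α • g α‖)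
    (F := fun (β : ℝ) (α : ℝ) => Complex.exp (Complex.I * (α : ℂ) * (β : ℂ)) * g α)
    (F' := fun (β : ℝ) (α : ℝ) => Complex.exp (Complex.I * (α : ℂ) * (β : ℂ)) * (Complex.I * (α • g α)))
    Filter.univ_mem (Filter.Eventually.of_forall fun β => ?_) ?_ ?_ ?_ hg1.norm ?_).2
  · exact (Continuous.aestronglyMeasurable (by fun_prop)).mul hg.1
  · refine hg.norm.mono' ((Continuous.aestronglyMeasurable (by fun_prop)).mul hg.1) ?_
    refine Filter.Eventually.of_forall fun α => ?_
    rw [norm_mul, mul_assoc, ← Complex.ofReal_mul, mul_comm Complex.I,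
      Complex.norm_exp_ofReal_mul_I, one_mul]
  · exact (Continuous.aestronglyMeasurable (by fun_prop)).mul (hg1.1.const_mul _)
  · refine Filter.Eventually.of_forall fun α β _ => ?_
    rw [norm_mul, mul_assoc, ← Complex.ofReal_mul, mul_comm Complex.I,
      Complex.norm_exp_ofReal_mul_I, one_mul, norm_mul, Complex.norm_I, one_mul]
  · refine Filter.Eventually.of_forall fun α β _ => ?_
    have h1 : HasDerivAt (fun z : ℝ => Complex.I * (α : ℂ) * (z : ℂ)) (Complex.I * α * 1) β :=
      (Complex.ofRealCLM.hasDerivAt).const_mul _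
    have h2 := (h1.cexp).mul_const (g α)
    refine h2.congr_deriv ?_
    rw [Complex.real_smul]; ring

theorem comm_C11 (hA : IsSelfAdjoint A) (hM : IsNuc (B * A - A * B)) {φ : ℝ → ℂ}
    (hφ : MemC11 φ) :
    Continuous φ ∧ Differentiable ℝ φ ∧ Continuous (deriv φ) ∧
    IsNuc (B * fc φ A - fc φ A * B) ∧
      trace e (B * fc φ A - fc φ A * B) = trace e (fc (deriv φ) A * (B * A - A * B)) := by
  obtain ⟨g, hg, hg1, hφ⟩ := hφ
  set c0 : ℂ := (((Real.sqrt (2 * Real.pi))⁻¹ : ℝ) : ℂ) with hc0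
  have hφ' : φ = fun β : ℝ => c0 * ∫ α : ℝ, Complex.exp (Complex.I * (α : ℂ) * (β : ℂ)) * g α := by
    ext β; rw [hφ β, Complex.real_smul]; rfl
  have hg2 : Integrable (fun α : ℝ => Complex.I * (α • g α)) := hg1.const_mul _
  have hd : ∀ β : ℝ, HasDerivAt φ (c0 * ∫ α : ℝ, Complex.exp (Complex.I * (α : ℂ) * (β : ℂ)) *
      (Complex.I * (α • g α))) β := by
    intro β; rw [hφ']; exact (fourier_deriv hg hg1 β).const_mul c0
  have hdf : deriv φ = fun β : ℝ => c0 * ∫ α : ℝ, Complex.exp (Complex.I * (α : ℂ) * (β : ℂ)) *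
      (Complex.I * (α • g α)) := by
    ext β; exact (hd β).deriv
  have hdiff : Differentiable ℝ φ := fun β => (hd β).differentiableAt
  refine ⟨hdiff.continuous, hdiff, by rw [hdf]; exact continuous_const.mul (fourier_cont hg2), ?_⟩
  have f1 : fc φ A = c0 • ∫ α, g α • Eop A α := by
    rw [hφ', fc_const_mul _ (fourier_cont hg), (fc_fourier hA hg).2]
  have f2 : fc (deriv φ) A = c0 • ∫ α : ℝ, (Complex.I * (α • g α)) • Eop A α := by
    rw [hdf, fc_const_mul _ (fourier_cont hg2), (fc_fourier hA hg2).2]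
  obtain ⟨Ω, mΩ, μ, u, v, hsf, hrep⟩ := hM
  have hE := Eop_cont hA
  -- the two applications of the integral lemma
  have i1 := (fc_fourier hA hg).1
  have i2 := (fc_fourier hA hg2).1
  have hk : Integrable (fun α : ℝ => c0 * (Complex.I * (α • g α))) := hg2.const_mul _
  have one_le : ‖(1 : H →L[ℂ] H)‖ ≤ 1 := ContinuousLinearMap.norm_id_le
  have hM0 : ∀ x y α, ⟪x, (Eop A α * (B * A - A * B) * 1) y⟫_ℂ =
      ⟪x, Eop A α ((B * A - A * B) y)⟫_ℂ := fun x y α => by rw [mul_one]; rfl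
  have key2 := rep_integral e hrep (ν := (volume : Measure ℝ)) (L := Eop A) (R := fun _ => 1)
    hE.aestronglyMeasurable aestronglyMeasurable_const (Eop_norm hA) (fun _ => one_le) hk
    (Z := fc (deriv φ) A * (B * A - A * B)) (by
      intro x y
      rw [f2, mul_apply_eq_comp, smul_apply, inner_smul_right, inner_integral_apply i2,
        ← integral_const_mul]
      refine integral_congr_ae (Filter.Eventually.of_forall fun α => ?_)
      simp only [hM0, smul_apply, inner_smul_right]
      ring)
  set ν : Measure (ℝ × ℝ) := (volume : Measure ℝ).prod (volume.restrict (Set.Ioc (0 : ℝ) 1)) with hν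
  have hk2 : Integrable (fun s : ℝ × ℝ => c0 * (Complex.I * (s.1 • g s.1))) ν := hk.comp_fst _
  have hbr : B * fc φ A - fc φ A * B = c0 • ∫ α, g α • (B * Eop A α - Eop A α * B) := by
    let T : (H →L[ℂ] H) →L[ℂ] (H →L[ℂ] H) :=
      ContinuousLinearMap.mul ℂ (H →L[ℂ] H) B - (ContinuousLinearMap.mul ℂ (H →L[ℂ] H)).flip B
    have hT : ∀ Z, T Z = B * Z - Z * B := fun Z => rfl
    rw [← hT, f1, map_smul, ← T.integral_comp_comm i1]
    simp only [hT, mul_smul_comm, smul_mul_assoc, smul_sub]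
  have i3 : Integrable (fun α => g α • (B * Eop A α - Eop A α * B)) := by
    refine ((hg.norm.mul_const (2 * ‖B‖)).mono' (hg.1.smul
      (Continuous.aestronglyMeasurable (by fun_prop))) (Filter.Eventually.of_forall fun α => ?_))
    rw [norm_smul]
    gcongr
    calc _ ≤ ‖B‖ * ‖Eop A α‖ + ‖Eop A α‖ * ‖B‖ :=
          (norm_sub_le _ _).trans (add_le_add (norm_mul_le _ _) (norm_mul_le _ _))
      _ ≤ ‖B‖ * 1 + 1 * ‖B‖ := by gcongr <;> exact Eop_norm hA α
      _ = _ := by ring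
  have hb3 : ∀ α r : ℝ, ‖Eop A (r * α) * (B * A - A * B) * Eop A ((1 - r) * α)‖ ≤
      ‖B * A - A * B‖ := by
    intro α r
    calc _ ≤ ‖Eop A (r * α)‖ * ‖B * A - A * B‖ * ‖Eop A ((1 - r) * α)‖ :=
          (norm_mul_le _ _).trans (by gcongr; exact norm_mul_le _ _)
      _ ≤ 1 * ‖B * A - A * B‖ * 1 := by gcongr <;> exact Eop_norm hA _
      _ = _ := by ring
  have key1 := rep_integral e hrep (ν := ν) (L := fun s => Eop A (s.2 * s.1))
    (R := fun s => Eop A ((1 - s.2) * s.1))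
    (Continuous.aestronglyMeasurable (by fun_prop)) (Continuous.aestronglyMeasurable (by fun_prop))
    (fun _ => Eop_norm hA _) (fun _ => Eop_norm hA _) hk2
    (Z := B * fc φ A - fc φ A * B) (by
      intro x y
      rw [hbr, smul_apply, inner_smul_right, inner_integral_apply i3,
        ← integral_const_mul, hν, integral_prod]
      · refine integral_congr_ae (Filter.Eventually.of_forall fun α => ?_)
        have hi4 : Integrable (fun r => (Complex.I * α) • (Eop A (r * α) * (B * A - A * B) *
            Eop A ((1 - r) * α))) (volume.restrict (Set.Ioc (0 : ℝ) 1)) :=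
          (Continuous.integrableOn_Ioc (by fun_prop))
        simp only [smul_apply, inner_smul_right]
        rw [comm_Eop hA, intervalIntegral.integral_of_le zero_le_one, inner_integral_apply hi4,
          integral_const_mul]
        simp only [smul_apply, inner_smul_right]
        rw [integral_const_mul, Complex.real_smul]
        ring
      · refine (hk2.norm.mul_const (‖x‖ * (‖B * A - A * B‖ * ‖y‖))).mono' ?_ ?_
        · refine hk2.1.mul (Continuous.aestronglyMeasurable ?_)
          refine continuous_const.inner ?_
          exact Continuous.clm_apply (by fun_prop) continuous_const
        · refine Filter.Eventually.of_forall fun s => ?_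
          rw [norm_mul]
          gcongr
          refine (norm_inner_le_norm _ _).trans ?_
          gcongr
          exact ContinuousLinearMap.le_of_opNorm_le _ (hb3 _ _) _)
  refine ⟨key1.1, ?_⟩
  rw [key1.2, key2.2]
  have hM : IsNuc (B * A - A * B) := ⟨Ω, mΩ, μ, u, v, hsf, hrep⟩
  have e1 : ∀ s : ℝ × ℝ, trace e (Eop A (s.2 * s.1) * (B * A - A * B) * Eop A ((1 - s.2) * s.1)) =
      trace e (Eop A s.1 * (B * A - A * B)) := by
    intro s
    rw [tr_comm e (hM.left _), ← mul_assoc, Eop_mul]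
    congr 3; ring
  simp only [e1, mul_one]
  rw [hν, integral_fun_fst (fun α : ℝ => c0 * (Complex.I * α • g α) *
    trace e (Eop A α * (B * A - A * B)))]
  simp

theorem deriv_polyFun (p : ℂ[X]) :
    deriv (fun t : ℝ => p.eval (t : ℂ)) = fun t : ℝ => (derivative p).eval (t : ℂ) := by
  ext t
  exact (p.hasDerivAt (t : ℂ)).comp_ofReal.deriv

/-- The commutator lemma for both classes. -/
theorem comm_fc (hA : IsSelfAdjoint A) (hM : IsNuc (B * A - A * B))
    {P : (ℝ → ℂ) → Prop} (hP : P = MemC11 ∨ P = IsPolyFun) {φ : ℝ → ℂ} (hφ : P φ) :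
    Continuous φ ∧ Differentiable ℝ φ ∧ Continuous (deriv φ) ∧
    IsNuc (B * fc φ A - fc φ A * B) ∧
      trace e (B * fc φ A - fc φ A * B) = trace e (fc (deriv φ) A * (B * A - A * B)) := by
  rcases hP with rfl | rfl
  · exact comm_C11 e hA hM hφ
  · obtain ⟨p, hp⟩ := hφ
    obtain rfl : φ = fun t : ℝ => p.eval (t : ℂ) := funext hp
    have hd : Differentiable ℝ (fun t : ℝ => p.eval (t : ℂ)) := fun t =>
      (p.hasDerivAt (t : ℂ)).comp_ofReal.differentiableAt
    refine ⟨hd.continuous, hd, ?_, ?_⟩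
    · rw [deriv_polyFun]; fun_prop
    · rw [deriv_polyFun, fc_poly hA, fc_poly hA]
      exact comm_poly e hM p

end commC

/-! ### Real analysis tools -/

section tools

theorem riesz {a b : ℝ} (hab : a ≤ b) (L : (ℝ → ℝ) → ℝ)
    (hadd : ∀ f g, Continuous f → Continuous g → L (fun t => f t + g t) = L f + L g)
    (hsmul : ∀ (c : ℝ) f, Continuous f → L (fun t => c * f t) = c * L f)
    (hpos : ∀ f, Continuous f → (∀ t ∈ Set.Icc a b, 0 ≤ f t) → 0 ≤ L f) :
    ∃ ν : Measure ℝ, IsFiniteMeasure ν ∧ ν (Set.Icc a b)ᶜ = 0 ∧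
      ∀ f, Continuous f → L f = ∫ t, f t ∂ν := by
  have hmono : ∀ f g, Continuous f → Continuous g → (∀ t ∈ Set.Icc a b, f t ≤ g t) → L f ≤ L g := by
    intro f g hf hg h
    have h1 := hpos (fun t => g t + (-1) * f t) (by fun_prop) (fun t ht => by linarith [h t ht])
    rw [hadd g (fun t => (-1) * f t) hg (by fun_prop), hsmul _ f hf] at h1
    linarith
  let ext : C(Set.Icc a b, ℝ) → ℝ → ℝ := fun f => Set.IccExtend hab f
  have hext : ∀ f, Continuous (ext f) := fun f => f.continuous.Icc_extend'
  let Λ0 : CompactlySupportedContinuousMap (Set.Icc a b) ℝ →ₗ[ℝ] ℝ :=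
    { toFun := fun f => L (ext f.toContinuousMap)
      map_add' := fun f g => hadd _ _ (hext _) (hext _)
      map_smul' := fun c f => hsmul c _ (hext _) }
  let Λ : CompactlySupportedContinuousMap (Set.Icc a b) ℝ →ₚ[ℝ] ℝ :=
    PositiveLinearMap.mk₀ Λ0 (fun f hf => hpos _ (hext _) (fun t ht => by
      show 0 ≤ Set.IccExtend hab f t
      rw [Set.IccExtend_of_mem hab _ ht]
      exact hf _))
  refine ⟨(RealRMK.rieszMeasure Λ).map Subtype.val, inferInstance, ?_, fun f hf => ?_⟩
  · rw [Measure.map_apply measurable_subtype_coe measurableSet_Icc.compl]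
    convert measure_empty (μ := RealRMK.rieszMeasure Λ)
    ext x; simp only [Set.mem_preimage, Set.mem_compl_iff, Set.mem_empty_iff_false, iff_false]
    exact fun h => h x.2
  · rw [integral_map measurable_subtype_coe.aemeasurable hf.aestronglyMeasurable]
    let f' : CompactlySupportedContinuousMap (Set.Icc a b) ℝ :=
      CompactlySupportedContinuousMap.continuousMapEquiv ⟨fun x => f x, by fun_prop⟩
    have := RealRMK.integral_rieszMeasure Λ f'
    have h2 : ∫ x : Set.Icc a b, f x ∂(RealRMK.rieszMeasure Λ) = L (ext f'.toContinuousMap) := this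
    rw [h2]
    have h3 : ∀ t ∈ Set.Icc a b, ext f'.toContinuousMap t = f t := by
      intro t ht
      show Set.IccExtend hab f' t = f t
      rw [Set.IccExtend_of_mem hab _ ht]; rfl
    exact le_antisymm (hmono _ _ hf (hext _) fun t ht => (h3 t ht).ge)
      (hmono _ _ (hext _) hf fun t ht => (h3 t ht).le)

/-- `f` is a sequence of continuous cutoffs decreasing to `K`. -/
structure Cutoff (K : Set ℝ) (f : ℕ → ℝ → ℝ) : Prop where
  cont : ∀ n, Continuous (f n)
  nonneg : ∀ n t, 0 ≤ f n t
  le_one : ∀ n t, f n t ≤ 1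
  one : ∀ n, ∀ t ∈ K, f n t = 1
  lim : ∀ t, Filter.Tendsto (fun n => f n t) Filter.atTop (nhds (K.indicator (fun _ => 1) t))

theorem exists_cutoff {K : Set ℝ} (hK : IsClosed K) : ∃ f, Cutoff K f := by
  refine ⟨fun n t => (hK.apprSeq n t : ℝ), fun n => ?_, fun n t => NNReal.coe_nonneg _,
    fun n t => ?_, fun n t ht => ?_, fun t => ?_⟩
  · exact NNReal.continuous_coe.comp (hK.apprSeq n).continuous
  · exact_mod_cast HasOuterApproxClosed.apprSeq_apply_le_one hK n t
  · exact_mod_cast HasOuterApproxClosed.apprSeq_apply_eq_one hK n ht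
  · have h := tendsto_pi_nhds.1 (HasOuterApproxClosed.tendsto_apprSeq hK) t
    have h2 := (NNReal.continuous_coe.tendsto _).comp h
    refine h2.congr' (Filter.Eventually.of_forall fun n => rfl) |>.trans ?_
    by_cases ht : t ∈ K <;> simp [ht]

theorem Cutoff.tendsto {K : Set ℝ} {f : ℕ → ℝ → ℝ} (hf : Cutoff K f) (hK : MeasurableSet K)
    {E : Type*} [NormedAddCommGroup E] [NormedSpace ℝ E] {ν : Measure ℝ} {h : ℝ → E}
    (hh : Integrable h ν) :
    Filter.Tendsto (fun n => ∫ t, f n t • h t ∂ν) Filter.atTop (nhds (∫ t in K, h t ∂ν)) := by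
  rw [← integral_indicator hK]
  refine tendsto_integral_of_dominated_convergence (fun t => ‖h t‖)
    (fun n => (hf.cont n).aestronglyMeasurable.smul hh.1) hh.norm
    (fun n => Filter.Eventually.of_forall fun t => ?_)
    (Filter.Eventually.of_forall fun t => ?_)
  · rw [norm_smul, Real.norm_of_nonneg (hf.nonneg n t)]
    exact mul_le_of_le_one_left (norm_nonneg _) (hf.le_one n t)
  · have := (hf.lim t).smul_const (h t)
    by_cases ht : t ∈ K <;> simpa [ht] using this

theorem weierstrass_real {f : ℝ → ℝ} (hf : Continuous f) (a b : ℝ) {ε : ℝ} (hε : 0 < ε) :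
    ∃ p : ℝ[X], ∀ t ∈ Set.Icc a b, |p.eval t - f t| < ε :=
  exists_polynomial_near_of_continuousOn a b f hf.continuousOn ε hε

theorem eval_map_ofReal (p : ℝ[X]) (t : ℝ) :
    (p.map (algebraMap ℝ ℂ)).eval (t : ℂ) = ((p.eval t : ℝ) : ℂ) := by
  rw [← Complex.coe_algebraMap, eval_map_algebraMap, aeval_algebraMap_apply]
  simp

theorem weierstrass {f : ℝ → ℂ} (hf : Continuous f) (a b : ℝ) {ε : ℝ} (hε : 0 < ε) :
    ∃ p : ℂ[X], ∀ t ∈ Set.Icc a b, ‖p.eval (t : ℂ) - f t‖ < ε := by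
  obtain ⟨p, hp⟩ := weierstrass_real (f := fun t => (f t).re) (by fun_prop) a b (half_pos hε)
  obtain ⟨q, hq⟩ := weierstrass_real (f := fun t => (f t).im) (by fun_prop) a b (half_pos hε)
  refine ⟨p.map (algebraMap ℝ ℂ) + C Complex.I * q.map (algebraMap ℝ ℂ), fun t ht => ?_⟩
  rw [eval_add, eval_mul, eval_C, eval_map_ofReal, eval_map_ofReal]
  refine (Complex.norm_le_abs_re_add_abs_im _).trans_lt ?_
  have h1 := hp t ht
  have h2 := hq t ht
  simp
  linarith

end tools

/-! ### Absolute continuity of the spectral measures -/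

section ac

theorem ac_of_interval {ν : Measure ℝ} {K : ℝ} (hK : 0 < K)
    (h : ∀ c d : ℝ, c ≤ d → ν (Set.Icc c d) ≤ ENNReal.ofReal (K * (d - c))) {N : Set ℝ}
    (hN : (volume : Measure ℝ) N = 0) : ν N = 0 := by
  have hK' : ENNReal.ofReal K ≠ 0 := by simpa using hK
  have hK'' : ENNReal.ofReal K ≠ ⊤ := ENNReal.ofReal_ne_top
  have h1 : ((ENNReal.ofReal K)⁻¹ • ν).toOuterMeasure ≤ StieltjesFunction.id.outer := by
    refine OuterMeasure.le_ofFunction.2 fun s => ?_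
    rw [StieltjesFunction.length_eq]
    refine le_iInf fun c => le_iInf fun d => le_iInf fun hs => ?_
    have hs' : s ⊆ Set.Ioc c d := by
      intro x hx; exact hs ⟨hx, fun h => not_isBot x (by simpa [botSet] using h)⟩
    rcases le_or_gt c d with hcd | hcd
    · show (ENNReal.ofReal K)⁻¹ * ν s ≤ ENNReal.ofReal (d - c)
      rw [← ENNReal.mul_le_mul_iff_right hK' hK'', ← mul_assoc, ENNReal.mul_inv_cancel hK' hK'',
        one_mul, ← ENNReal.ofReal_mul hK.le]
      exact (measure_mono (hs'.trans Set.Ioc_subset_Icc_self)).trans (h c d hcd)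
    · have : s = ∅ := Set.subset_eq_empty hs' (Set.Ioc_eq_empty (not_lt.2 hcd.le))
      subst this
      show (ENNReal.ofReal K)⁻¹ * ν ∅ ≤ _
      simp
  have h2 := h1 N
  have h3 : StieltjesFunction.id.outer N = (volume : Measure ℝ) N := by
    rw [Real.volume_eq_stieltjes_id, StieltjesFunction.measure]; rfl
  rw [h3, hN] at h2
  have h4 : (ENNReal.ofReal K)⁻¹ * ν N ≤ 0 := h2
  have h5 := le_antisymm h4 zero_le
  rcases mul_eq_zero.1 h5 with h6 | h6
  · exact absurd h6 (ENNReal.inv_ne_zero.2 hK'')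
  · exact h6

/-- Scalar spectral measure. -/
theorem spectral {X : H →L[ℂ] H} (hX : IsSelfAdjoint X) {a b : ℝ} (hab : a ≤ b)
    (hs : spectrum ℝ X ⊆ Set.Icc a b) (x : H) :
    ∃ ν : Measure ℝ, IsFiniteMeasure ν ∧ ν (Set.Icc a b)ᶜ = 0 ∧
      (∀ f : ℝ → ℝ, Continuous f → (⟪x, fc (fun t => (f t : ℂ)) X x⟫_ℂ).re = ∫ t, f t ∂ν) ∧
      ∀ f : ℝ → ℝ, Continuous f → ‖fc (fun t => (f t : ℂ)) X x‖ ^ 2 = ∫ t, f t ^ 2 ∂ν := by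
  obtain ⟨ν, h1, h2, h3⟩ := riesz hab (fun f => (⟪x, fc (fun t => (f t : ℂ)) X x⟫_ℂ).re)
    (fun f g hf hg => by
      have := fc_add (A := X) (f := fun t => (f t : ℂ)) (g := fun t => (g t : ℂ))
        (by fun_prop) (by fun_prop)
      simp only [Complex.ofReal_add]
      rw [this, add_apply, inner_add_right, Complex.add_re])
    (fun c f hf => by
      have := fc_const_mul (A := X) (c : ℂ) (f := fun t => (f t : ℂ)) (by fun_prop)
      simp only [Complex.ofReal_mul]
      rw [this, smul_apply, inner_smul_right, Complex.re_ofReal_mul])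
    (fun f hf h => fc_pos hX hs hf h x)
  refine ⟨ν, h1, h2, h3, fun f hf => ?_⟩
  rw [← h3 (fun t => f t ^ 2) (by fun_prop)]
  have e1 : fc (fun t => ((f t ^ 2 : ℝ) : ℂ)) X =
      fc (fun t => (f t : ℂ)) X * fc (fun t => (f t : ℂ)) X := by
    rw [← fc_mul (by fun_prop) (by fun_prop)]; congr 1; ext t; push_cast; ring
  rw [e1, mul_apply_eq_comp, ← ContinuousLinearMap.adjoint_inner_left,
    (ContinuousLinearMap.isSelfAdjoint_iff'.1 (fc_selfAdjoint f))]
  exact norm_sq_eq_re_inner (𝕜 := ℂ) _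

variable {X Y D2 S : H →L[ℂ] H} {a b : ℝ}

theorem ac1_bound (hX : IsSelfAdjoint X) (hS : IsSelfAdjoint S) (hSS : S * S = D2)
    (hD : D2 = (-Complex.I) • (Y * X - X * Y)) (hs : spectrum ℝ X ⊆ Set.Icc a b)
    {f : ℝ → ℝ} (hf : Continuous f) (h0 : ∀ t, 0 ≤ f t) (h1 : ∀ t, f t ≤ 1) {m l : ℝ} (hl : 0 ≤ l)
    (hsupp : ∀ t, l ≤ |t - m| → f t = 0) (w : H) :
    ‖fc (fun t => (f t : ℂ)) X (S w)‖ ^ 2 ≤ 2 * ‖Y‖ * l * ‖w‖ ^ 2 := by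
  set F := fc (fun t => (f t : ℂ)) X with hF
  set G := fc (fun t => ((f t * (t - m) : ℝ) : ℂ)) X with hG
  have hFsa : IsSelfAdjoint F := fc_selfAdjoint f
  have hFa : ContinuousLinearMap.adjoint F = F := ContinuousLinearMap.isSelfAdjoint_iff'.1 hFsa
  have hSa : ContinuousLinearMap.adjoint S = S := ContinuousLinearMap.isSelfAdjoint_iff'.1 hS
  have hFn : ‖F‖ ≤ 1 := fc_norm_le hX hs zero_le_one fun t _ => by
    rw [Complex.norm_real, Real.norm_of_nonneg (h0 t)]; exact h1 t
  have hGn : ‖G‖ ≤ l := fc_norm_le hX hs hl fun t _ => by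
    rw [Complex.norm_real, norm_mul, Real.norm_of_nonneg (h0 t), Real.norm_eq_abs]
    rcases le_or_gt l |t - m| with h | h
    · rw [hsupp t h, zero_mul]; exact hl
    · nlinarith [h1 t, h0 t, abs_nonneg (t - m)]
  have hid := fc_id hX
  have hxm : Continuous (fun t : ℝ => ((t : ℂ) - m)) := by fun_prop
  have hXm : fc (fun t : ℝ => ((t : ℂ) - m * 1)) X = X - (m : ℂ) • 1 := by
    rw [fc_sub (f := fun t : ℝ => (t : ℂ)) (g := fun _ => (m : ℂ) * 1) (by fun_prop) (by fun_prop),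
      hid, fc_const_mul (m : ℂ) (f := fun _ => (1 : ℂ)) (by fun_prop), fc_one hX]
  have hG1 : G = F * (X - (m : ℂ) • 1) := by
    rw [← hXm, hF, hG, ← fc_mul (by fun_prop) (by fun_prop)]
    congr 1; ext t; push_cast; ring
  have hG2 : G = (X - (m : ℂ) • 1) * F := by
    rw [← hXm, hF, hG, ← fc_mul (by fun_prop) (by fun_prop)]
    congr 1; ext t; push_cast; ring
  have hFDF : F * D2 * F = (-Complex.I) • (F * Y * G - G * Y * F) := by
    rw [hD, mul_smul_comm, smul_mul_assoc]
    congr 1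
    nth_rewrite 1 [hG2]
    rw [hG1]
    simp only [mul_sub, sub_mul, mul_smul_comm, smul_mul_assoc, mul_one, one_mul, mul_assoc]
    abel
  have hn : ‖F * D2 * F‖ ≤ 2 * ‖Y‖ * l := by
    rw [hFDF, norm_smul, norm_neg, Complex.norm_I, one_mul]
    calc _ ≤ ‖F‖ * ‖Y‖ * ‖G‖ + ‖G‖ * ‖Y‖ * ‖F‖ := by
          refine (norm_sub_le _ _).trans (add_le_add ?_ ?_) <;>
          exact (norm_mul_le _ _).trans (by gcongr; exact norm_mul_le _ _)
      _ ≤ 1 * ‖Y‖ * l + l * ‖Y‖ * 1 := by gcongr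
      _ = _ := by ring
  have hFS : ‖F * S‖ ^ 2 ≤ 2 * ‖Y‖ * l := by
    have h := CStarRing.norm_self_mul_star (x := F * S)
    rw [star_mul, ContinuousLinearMap.star_eq_adjoint, ContinuousLinearMap.star_eq_adjoint,
      hFa, hSa, mul_assoc, ← mul_assoc S S, hSS, ← mul_assoc] at h
    rw [sq, ← h]; exact hn
  calc ‖F (S w)‖ ^ 2 ≤ (‖F * S‖ * ‖w‖) ^ 2 := by gcongr; exact (F * S).le_opNorm w
    _ = ‖F * S‖ ^ 2 * ‖w‖ ^ 2 := by ring
    _ ≤ _ := by gcongr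

theorem ac1 (hX : IsSelfAdjoint X) (hS : IsSelfAdjoint S) (hSS : S * S = D2)
    (hD : D2 = (-Complex.I) • (Y * X - X * Y)) (hs : spectrum ℝ X ⊆ Set.Icc a b) (w : H)
    {ν : Measure ℝ} [IsFiniteMeasure ν]
    (hν : ∀ f : ℝ → ℝ, Continuous f → ‖fc (fun t => (f t : ℂ)) X (S w)‖ ^ 2 = ∫ t, f t ^ 2 ∂ν)
    {N : Set ℝ} (hN : (volume : Measure ℝ) N = 0) : ν N = 0 := by
  set K : ℝ := ‖Y‖ * ‖w‖ ^ 2 with hK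
  refine ac_of_interval (K := K + 1) (by positivity) (fun c d hcd => ?_) hN
  have key : ∀ δ : ℝ, 0 < δ → ν.real (Set.Icc c d) ≤ K * (d - c) + 2 * K * δ := by
    intro δ hδ
    set m := (c + d) / 2 with hm
    set l := (d - c) / 2 with hl
    let f : ℝ → ℝ := fun t => max 0 (min 1 (1 - (|t - m| - l) / δ))
    have hf : Continuous f := by fun_prop
    have hf0 : ∀ t, 0 ≤ f t := fun t => le_max_left _ _
    have hf1 : ∀ t, f t ≤ 1 := fun t => max_le zero_le_one (min_le_left _ _)
    have hl0 : 0 ≤ l := by rw [hl]; linarith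
    have hb := ac1_bound hX hS hSS hD hs hf hf0 hf1 (m := m) (l := l + δ) (by linarith)
      (fun t ht => by
        refine max_eq_left ((min_le_right _ _).trans ?_)
        have : 1 ≤ (|t - m| - l) / δ := by rw [le_div_iff₀ hδ]; linarith
        linarith) w
    rw [hν f hf] at hb
    have h1 : ν.real (Set.Icc c d) ≤ ∫ t, f t ^ 2 ∂ν := by
      rw [← integral_indicator_one measurableSet_Icc]
      refine integral_mono_of_nonneg (Filter.Eventually.of_forall fun t => ?_) ?_
        (Filter.Eventually.of_forall fun t => ?_)
      · exact Set.indicator_nonneg (fun _ _ => zero_le_one) _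
      · refine Integrable.mono' (integrable_const (1 : ℝ))
          (by exact (hf.pow 2).aestronglyMeasurable)
          (Filter.Eventually.of_forall fun t => ?_)
        rw [Real.norm_of_nonneg (by positivity)]
        exact pow_le_one₀ (hf0 t) (hf1 t)
      · by_cases ht : t ∈ Set.Icc c d
        · have : f t = 1 := by
            have h2 : |t - m| ≤ l := by
              rw [abs_le]; constructor <;> (rw [hm, hl]; linarith [ht.1, ht.2])
            have h3 : (|t - m| - l) / δ ≤ 0 := div_nonpos_of_nonpos_of_nonneg (by linarith) hδ.le
            show max 0 (min 1 (1 - (|t - m| - l) / δ)) = 1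
            rw [min_eq_left (by linarith), max_eq_right zero_le_one]
          simp [ht, this]
        · simp only [ht, not_false_eq_true, Set.indicator_of_notMem]; positivity
    refine h1.trans (hb.trans (le_of_eq ?_))
    rw [hK, hl]; ring
  have h2 : ν.real (Set.Icc c d) ≤ K * (d - c) := by
    refine le_of_forall_pos_le_add fun ε hε => ?_
    have hK0 : 0 ≤ K := by positivity
    refine (key (ε / (2 * K + 1)) (by positivity)).trans ?_
    have : 2 * K * (ε / (2 * K + 1)) ≤ ε := by
      rw [mul_div_assoc', div_le_iff₀ (by positivity)]; nlinarith
    linarith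
  rw [← ENNReal.ofReal_toReal (measure_ne_top ν (Set.Icc c d))]
  refine ENNReal.ofReal_le_ofReal (h2.trans ?_)
  nlinarith

end ac

section ac2
variable {X Y D2 S : H →L[ℂ] H} {a b : ℝ}

theorem Cutoff.fc_norm (hX : IsSelfAdjoint X) (hs : spectrum ℝ X ⊆ Set.Icc a b) {N : Set ℝ}
    {f : ℕ → ℝ → ℝ} (hf : Cutoff N f) (n : ℕ) : ‖fc (fun t => (f n t : ℂ)) X‖ ≤ 1 :=
  fc_norm_le hX hs zero_le_one fun t _ => by
    rw [Complex.norm_real, Real.norm_of_nonneg (hf.nonneg n t)]; exact hf.le_one n t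

theorem Cutoff.sq_tendsto {N : Set ℝ} (hNm : MeasurableSet N) {f : ℕ → ℝ → ℝ} (hf : Cutoff N f)
    (ν : Measure ℝ) [IsFiniteMeasure ν] {g : ℝ → ℝ} (hg : Continuous g) (hg0 : ∀ t, ‖g t‖ ≤ 1) :
    Filter.Tendsto (fun n => ∫ t, (f n t * g t) ^ 2 ∂ν) Filter.atTop
      (nhds (∫ t in N, (g t) ^ 2 ∂ν)) := by
  rw [← integral_indicator hNm]
  refine tendsto_integral_of_dominated_convergence (fun _ => (1 : ℝ))
    (fun n => (((hf.cont n).mul hg).pow 2).aestronglyMeasurable) (integrable_const _)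
    (fun n => Filter.Eventually.of_forall fun t => ?_)
    (Filter.Eventually.of_forall fun t => ?_)
  · rw [norm_pow, norm_mul, Real.norm_of_nonneg (hf.nonneg n t)]
    exact pow_le_one₀ (by have := hf.nonneg n t; positivity)
      (mul_le_one₀ (hf.le_one n t) (norm_nonneg _) (hg0 t))
  · have := ((hf.lim t).mul_const (g t)).pow 2
    by_cases ht : t ∈ N <;> simpa [ht] using this

theorem fc_tendsto_zero_of_null (hX : IsSelfAdjoint X) (hab : a ≤ b)
    (hs : spectrum ℝ X ⊆ Set.Icc a b) {N : Set ℝ} (hN : IsClosed N) {f : ℕ → ℝ → ℝ}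
    (hf : Cutoff N f) (x : H)
    (h0 : ∀ ν : Measure ℝ, IsFiniteMeasure ν → (∀ f : ℝ → ℝ, Continuous f →
      ‖fc (fun t => (f t : ℂ)) X x‖ ^ 2 = ∫ t, f t ^ 2 ∂ν) → ν N = 0) :
    Filter.Tendsto (fun n => fc (fun t => (f n t : ℂ)) X x) Filter.atTop (nhds 0) := by
  obtain ⟨ν, h1, -, -, h4⟩ := spectral hX hab hs x
  have h5 := hf.sq_tendsto hN.measurableSet ν (g := fun _ => 1) continuous_const (by simp)
  simp only [mul_one, one_pow] at h5
  rw [Measure.restrict_eq_zero.2 (h0 ν h1 h4), integral_zero_measure] at h5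
  rw [tendsto_zero_iff_norm_tendsto_zero]
  have h6 : Filter.Tendsto (fun n => ‖fc (fun t => (f n t : ℂ)) X x‖ ^ 2) Filter.atTop (nhds 0) :=
    h5.congr fun n => (h4 _ (hf.cont n)).symm
  have h7 := h6.sqrt
  simpa using h7

theorem ac2 (hX : IsSelfAdjoint X) (hY : IsSelfAdjoint Y) (hS : IsSelfAdjoint S)
    (hSS : S * S = D2) (hD : D2 = (-Complex.I) • (Y * X - X * Y)) (hab : a ≤ b)
    (hs : spectrum ℝ X ⊆ Set.Icc a b) (hpure : PurelyHyponormal (X + Complex.I • Y))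
    {N : Set ℝ} (hN : IsClosed N) (hN0 : (volume : Measure ℝ) N = 0) {f : ℕ → ℝ → ℝ}
    (hf : Cutoff N f) (x : H) :
    Filter.Tendsto (fun n => fc (fun t => (f n t : ℂ)) X x) Filter.atTop (nhds 0) := by
  set F : ℕ → H →L[ℂ] H := fun n => fc (fun t => (f n t : ℂ)) X with hF
  have hFa : ∀ n, ContinuousLinearMap.adjoint (F n) = F n := fun n =>
    ContinuousLinearMap.isSelfAdjoint_iff'.1 (fc_selfAdjoint (f n))
  have hSa : ContinuousLinearMap.adjoint S = S := ContinuousLinearMap.isSelfAdjoint_iff'.1 hS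
  have hXa : ContinuousLinearMap.adjoint X = X := ContinuousLinearMap.isSelfAdjoint_iff'.1 hX
  have hYa : ContinuousLinearMap.adjoint Y = Y := ContinuousLinearMap.isSelfAdjoint_iff'.1 hY
  have hFX : ∀ n, F n * X = X * F n := fun n => by
    have := fc_comm (A := X) (fun t => (f n t : ℂ)) (fun t => (t : ℂ))
    rw [fc_id hX] at this
    exact this.eq
  -- the subspace
  let V : Submodule ℂ H := ⨅ n, LinearMap.ker ((F n - 1 : H →L[ℂ] H) : H →ₗ[ℂ] H)
  have hV : ∀ x, x ∈ V ↔ ∀ n, F n x = x := by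
    intro x
    simp only [V, Submodule.mem_iInf, LinearMap.mem_ker]
    refine forall_congr' fun n => ?_
    show F n x - x = 0 ↔ _
    rw [sub_eq_zero]
  have hVc : IsClosed (V : Set H) := by
    have : (V : Set H) = ⋂ n, {x | F n x = x} := by ext x; simp [hV]
    rw [this]
    exact isClosed_iInter fun n => isClosed_eq (F n).continuous continuous_id
  have hVX : ∀ x ∈ V, X x ∈ V := by
    intro x hx
    rw [hV] at hx ⊢
    intro n
    have := congrArg (fun Z : H →L[ℂ] H => Z x) (hFX n)
    simp only [mul_apply_eq_comp] at this
    rw [this, hx n]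
  have hVS : ∀ x ∈ V, S x = 0 := by
    intro x hx
    rw [hV] at hx
    rw [← inner_self_eq_zero (𝕜 := ℂ)]
    have h1 : ∀ n, ⟪F n (S (S x)), x⟫_ℂ = ⟪S x, S x⟫_ℂ := by
      intro n
      rw [← hFa, ContinuousLinearMap.adjoint_inner_left, hx n]
      nth_rewrite 1 [← hSa]
      rw [ContinuousLinearMap.adjoint_inner_left]
    have h2 : Filter.Tendsto (fun n => F n (S (S x))) Filter.atTop (nhds 0) :=
      fc_tendsto_zero_of_null hX hab hs hN hf (S (S x)) fun ν hν1 hν2 =>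
        ac1 hX hS hSS hD hs (S x) hν2 hN0
    have h3 := h2.inner (tendsto_const_nhds (x := x)) (𝕜 := ℂ)
    simp only [h1, inner_zero_left] at h3
    exact tendsto_nhds_unique tendsto_const_nhds h3
  have hVD : ∀ x ∈ V, D2 x = 0 := fun x hx => by
    rw [← hSS, mul_apply_eq_comp, hVS x hx, map_zero]
  have hcomm : ∀ x ∈ V, X (Y x) = Y (X x) := by
    intro x hx
    have := hVD x hx
    rw [hD, smul_apply, smul_eq_zero] at this
    rcases this with h | h
    · simp at h
    · rw [sub_apply, mul_apply_eq_comp, mul_apply_eq_comp, sub_eq_zero] at h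
      exact h.symm
  have hpow : ∀ k : ℕ, ∀ x ∈ V, (X ^ k) x ∈ V ∧ (X ^ k) (Y x) = Y ((X ^ k) x) := by
    intro k
    induction k with
    | zero => intro x hx; simpa using hx
    | succ k ih =>
      intro x hx
      obtain ⟨h1, h2⟩ := ih x hx
      rw [pow_succ', mul_apply_eq_comp, mul_apply_eq_comp, h2]
      exact ⟨hVX _ h1, hcomm _ h1⟩
  have hpoly : ∀ (p : ℂ[X]) (x : H), x ∈ V → (aeval X p) (Y x) = Y ((aeval X p) x) := by
    intro p x hx
    induction p using Polynomial.induction_on' with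
    | add p q hp hq => simp [map_add, hp, hq]
    | monomial k c =>
      rw [aeval_monomial, Algebra.algebraMap_eq_smul_one, smul_mul_assoc, one_mul, smul_apply,
        smul_apply, map_smul, (hpow k x hx).2]
  have hFY : ∀ n, ∀ x ∈ V, F n (Y x) = Y (F n x) := by
    intro n x hx
    rw [← sub_eq_zero, ← norm_le_zero_iff]
    refine le_of_forall_pos_le_add fun ε hε => ?_
    rw [zero_add]
    set δ := ε / (2 * ‖Y‖ * ‖x‖ + 1) with hδ
    have hδ0 : 0 < δ := by positivity
    obtain ⟨p, hp⟩ := weierstrass (f := fun t => (f n t : ℂ))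
      (by have := hf.cont n; fun_prop) a b hδ0
    have h1 : ‖F n - aeval X p‖ ≤ δ := by
      rw [← fc_poly hX, hF]
      dsimp only
      rw [← fc_sub (by have := hf.cont n; fun_prop) (by fun_prop)]
      refine fc_norm_le hX hs hδ0.le fun t ht => ?_
      rw [norm_sub_rev]; exact (hp t ht).le
    have h2 : F n (Y x) - Y (F n x) = (F n - aeval X p) (Y x) - Y ((F n - aeval X p) x) := by
      rw [sub_apply, sub_apply, map_sub, hpoly p x hx]; abel
    rw [h2]
    calc _ ≤ δ * (‖Y‖ * ‖x‖) + ‖Y‖ * (δ * ‖x‖) := by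
          refine (norm_sub_le _ _).trans (add_le_add ?_ ?_)
          · refine (ContinuousLinearMap.le_of_opNorm_le _ h1 _).trans ?_
            gcongr; exact Y.le_opNorm x
          · refine (Y.le_opNorm _).trans ?_
            gcongr; exact ContinuousLinearMap.le_of_opNorm_le _ h1 _
      _ = δ * (2 * ‖Y‖ * ‖x‖) := by ring
      _ ≤ δ * (2 * ‖Y‖ * ‖x‖ + 1) := by gcongr; linarith
      _ = ε := by rw [hδ]; field_simp
  have hVY : ∀ x ∈ V, Y x ∈ V := by
    intro x hx
    rw [hV]; intro n
    rw [hFY n x hx, (hV x).1 hx n]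
  have hTa : ContinuousLinearMap.adjoint (X + Complex.I • Y) = X - Complex.I • Y := by
    rw [map_add, hXa, LinearIsometryEquiv.map_smulₛₗ, hYa, sub_eq_add_neg]
    simp
  have hVbot : V = ⊥ := by
    refine hpure.2 V hVc (fun x hx => ?_) (fun x hx => ?_) (fun x hx => ?_)
    · exact V.add_mem (hVX x hx) (V.smul_mem _ (hVY x hx))
    · rw [hTa]
      exact V.sub_mem (hVX x hx) (V.smul_mem _ (hVY x hx))
    · set T := X + Complex.I • Y with hT
      have h1 : ContinuousLinearMap.adjoint T (T x) = T (ContinuousLinearMap.adjoint T x) := by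
        rw [hTa, hT]
        simp only [add_apply, sub_apply, smul_apply, map_add, map_sub, map_smul, hcomm x hx]
        module
      have h2 : ‖T x‖ ^ 2 = ‖ContinuousLinearMap.adjoint T x‖ ^ 2 := by
        rw [norm_sq_eq_re_inner (𝕜 := ℂ), norm_sq_eq_re_inner (𝕜 := ℂ),
          ContinuousLinearMap.adjoint_inner_left, ← h1,
          ContinuousLinearMap.adjoint_inner_right]
      exact (sq_eq_sq₀ (norm_nonneg _) (norm_nonneg _)).1 h2
  -- the limit exists and lies in `V`
  obtain ⟨ν, hν1, -, -, hν⟩ := spectral hX hab hs x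
  set c : ℕ → ℝ := fun n => ∫ t, (f n t - N.indicator (fun _ => (1 : ℝ)) t) ^ 2 ∂ν with hc
  have hNm := hN.measurableSet
  have hind : Measurable (N.indicator (fun _ => (1 : ℝ))) := measurable_const.indicator hNm
  have hind0 : ∀ t, 0 ≤ N.indicator (fun _ => (1 : ℝ)) t ∧ N.indicator (fun _ => (1 : ℝ)) t ≤ 1 := by
    intro t; by_cases ht : t ∈ N <;> simp [ht]
  have hci : ∀ n, Integrable (fun t => (f n t - N.indicator (fun _ => (1 : ℝ)) t) ^ 2) ν := by
    intro n
    refine Integrable.mono' (integrable_const (1 : ℝ))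
      (((hf.cont n).measurable.sub hind).pow_const 2).aestronglyMeasurable
      (Filter.Eventually.of_forall fun t => ?_)
    rw [Real.norm_of_nonneg (by positivity), sq_le_one_iff_abs_le_one, abs_le]
    constructor <;> linarith [(hind0 t).1, (hind0 t).2, hf.nonneg n t, hf.le_one n t]
  have hc0 : Filter.Tendsto c Filter.atTop (nhds 0) := by
    have h0 : (0 : ℝ) = ∫ t, (0 : ℝ) ∂ν := by simp
    rw [h0]
    refine tendsto_integral_of_dominated_convergence (fun _ => (1 : ℝ))
      (fun n => (hci n).1) (integrable_const _)
      (fun n => Filter.Eventually.of_forall fun t => ?_)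
      (Filter.Eventually.of_forall fun t => ?_)
    · rw [Real.norm_of_nonneg (by positivity), sq_le_one_iff_abs_le_one, abs_le]
      constructor <;> linarith [(hind0 t).1, (hind0 t).2, hf.nonneg n t, hf.le_one n t]
    · have := ((hf.lim t).sub_const (N.indicator (fun _ => (1 : ℝ)) t)).pow 2
      simpa using this
  have hdiff : ∀ n m, ‖F n x - F m x‖ ^ 2 ≤ 2 * c n + 2 * c m := by
    intro n m
    have h1 : F n x - F m x = fc (fun t => ((f n t - f m t : ℝ) : ℂ)) X x := by
      simp only [Complex.ofReal_sub]
      rw [fc_sub (by have := hf.cont n; fun_prop) (by have := hf.cont m; fun_prop), sub_apply]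
    rw [h1, hν (fun t => f n t - f m t) ((hf.cont n).sub (hf.cont m)), hc]
    dsimp only
    rw [← integral_const_mul, ← integral_const_mul,
      ← integral_add ((hci n).const_mul 2) ((hci m).const_mul 2)]
    refine integral_mono_of_nonneg (Filter.Eventually.of_forall fun t => by positivity)
      (((hci n).const_mul 2).add ((hci m).const_mul 2)) (Filter.Eventually.of_forall fun t => ?_)
    dsimp only
    nlinarith [sq_nonneg (f n t - N.indicator (fun _ => (1 : ℝ)) t +
      (f m t - N.indicator (fun _ => (1 : ℝ)) t))]
  have hcau : CauchySeq (fun n => F n x) := by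
    rw [Metric.cauchySeq_iff]
    intro ε hε
    obtain ⟨n0, hn0⟩ := Filter.eventually_atTop.1
      (hc0.eventually (gt_mem_nhds (show (0 : ℝ) < ε ^ 2 / 4 by positivity)))
    refine ⟨n0, fun n hn m hm => ?_⟩
    rw [dist_eq_norm]
    refine lt_of_pow_lt_pow_left₀ 2 hε.le ((hdiff n m).trans_lt ?_)
    linarith [hn0 n hn, hn0 m hm]
  obtain ⟨y, hy⟩ := cauchySeq_tendsto_of_complete hcau
  have hyV : y ∈ V := by
    rw [hV]; intro m
    have h1 : Filter.Tendsto (fun n => F m (F n x)) Filter.atTop (nhds (F m y)) :=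
      ((F m).continuous.tendsto y).comp hy
    have h2 : Filter.Tendsto (fun n => F m (F n x) - F n x) Filter.atTop (nhds 0) := by
      rw [tendsto_zero_iff_norm_tendsto_zero]
      have hg : Continuous (fun t => f m t - 1) := (hf.cont m).sub continuous_const
      have h5 := hf.sq_tendsto hNm ν hg (fun t => by
        rw [Real.norm_eq_abs, abs_le]
        constructor <;> linarith [hf.nonneg m t, hf.le_one m t])
      have h6 : ∫ t in N, (f m t - 1) ^ 2 ∂ν = 0 := by
        rw [setIntegral_congr_fun hNm (g := fun _ => (0 : ℝ)) (fun t ht => by simp [hf.one m t ht])]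
        simp
      rw [h6] at h5
      have h7 : Filter.Tendsto (fun n => ‖F m (F n x) - F n x‖ ^ 2) Filter.atTop (nhds 0) := by
        refine h5.congr fun n => ?_
        rw [← hν (fun t => f n t * (f m t - 1)) ((hf.cont n).mul hg)]
        congr 3
        have e1 : fc (fun t => ((f n t * (f m t - 1) : ℝ) : ℂ)) X = F m * F n - F n := by
          rw [hF]; dsimp only
          have c1 := hf.cont n
          have c2 := hf.cont m
          rw [← fc_mul (by fun_prop) (by fun_prop), ← fc_sub (by fun_prop) (by fun_prop)]
          congr 1; ext t; push_cast; ring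
        rw [e1]; rfl
      simpa using h7.sqrt
    have h3 := h1.sub hy
    exact (sub_eq_zero.1 (tendsto_nhds_unique h3 h2))
  rw [hVbot, Submodule.mem_bot] at hyV
  rw [hyV] at hy
  exact hy

end ac2

/-! ### Densities of the functionals `f ↦ tr (f(X) K)` -/

section density
variable {X : H →L[ℂ] H} {a b : ℝ}

/-- Cutoffs of Lebesgue null sets converge strongly to zero in the functional calculus. -/
def AC (X : H →L[ℂ] H) : Prop :=
  ∀ N : Set ℝ, IsClosed N → (volume : Measure ℝ) N = 0 → ∀ f : ℕ → ℝ → ℝ, Cutoff N f → ∀ x : H,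
    Filter.Tendsto (fun n => fc (fun t => (f n t : ℂ)) X x) Filter.atTop (nhds 0)

variable {Ω : Type*} [MeasurableSpace Ω] {μ : Measure Ω}

theorem quad_meas {w : Ω → H} (hw : AEStronglyMeasurable w μ) (T : H →L[ℂ] H) :
    AEStronglyMeasurable (fun ω => ⟪w ω, T (w ω)⟫_ℂ) μ :=
  hw.inner (T.continuous.comp_aestronglyMeasurable hw)

theorem quad_norm_le (T : H →L[ℂ] H) (x : H) : ‖⟪x, T x⟫_ℂ‖ ≤ ‖T‖ * (‖x‖ * ‖x‖) := by
  calc _ ≤ ‖x‖ * ‖T x‖ := norm_inner_le_norm _ _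
    _ ≤ ‖x‖ * (‖T‖ * ‖x‖) := by gcongr; exact T.le_opNorm _
    _ = _ := by ring

theorem quad_int {w : Ω → H} (hw : AEStronglyMeasurable w μ)
    (hi : Integrable (fun ω => ‖w ω‖ * ‖w ω‖) μ) (T : H →L[ℂ] H) :
    Integrable (fun ω => ⟪w ω, T (w ω)⟫_ℂ) μ :=
  (hi.const_mul ‖T‖).mono' (quad_meas hw T)
    (Filter.Eventually.of_forall fun ω => quad_norm_le T (w ω))

theorem quad_density (hX : IsSelfAdjoint X) (hab : a ≤ b) (hs : spectrum ℝ X ⊆ Set.Icc a b)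
    (hac : AC X) {w : Ω → H} (hw : AEStronglyMeasurable w μ)
    (hi : Integrable (fun ω => ‖w ω‖ * ‖w ω‖) μ) :
    ∃ r : ℝ → ℝ, IntegrableOn r (Set.Icc a b) ∧ ∀ f : ℝ → ℝ, Continuous f →
      ∫ ω, (⟪w ω, fc (fun t => (f t : ℂ)) X (w ω)⟫_ℂ).re ∂μ = ∫ t in Set.Icc a b, f t * r t := by
  have hre : ∀ T : H →L[ℂ] H, Integrable (fun ω => (⟪w ω, T (w ω)⟫_ℂ).re) μ := fun T =>
    (quad_int hw hi T).re
  obtain ⟨ν, h1, h2, h3⟩ := riesz hab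
    (fun f => ∫ ω, (⟪w ω, fc (fun t => (f t : ℂ)) X (w ω)⟫_ℂ).re ∂μ)
    (fun f g hf hg => by
      have := fc_add (A := X) (f := fun t => (f t : ℂ)) (g := fun t => (g t : ℂ))
        (by fun_prop) (by fun_prop)
      simp only [Complex.ofReal_add, this, add_apply, inner_add_right, Complex.add_re]
      exact integral_add (hre _) (hre _))
    (fun c f hf => by
      have := fc_const_mul (A := X) (c : ℂ) (f := fun t => (f t : ℂ)) (by fun_prop)
      simp only [Complex.ofReal_mul, this, smul_apply, inner_smul_right, Complex.re_ofReal_mul]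
      exact integral_const_mul _ _)
    (fun f hf h0 => integral_nonneg fun ω => fc_pos hX hs hf h0 _)
  have hνac : ν ≪ volume := by
    have hcl : ∀ N : Set ℝ, IsClosed N → (volume : Measure ℝ) N = 0 → ν N = 0 := by
      intro N hN hN0
      obtain ⟨f, hf⟩ := exists_cutoff hN
      have t1 := hf.tendsto (ν := ν) hN.measurableSet (integrable_const (1 : ℝ))
      have t2 : Filter.Tendsto (fun n => ∫ t, f n t • (1 : ℝ) ∂ν) Filter.atTop (nhds 0) := by
        simp only [smul_eq_mul, mul_one]
        have h0 : (0 : ℝ) = ∫ ω, (0 : ℝ) ∂μ := by simp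
        rw [h0]
        simp only [← h3 _ (hf.cont _)]
        refine tendsto_integral_of_dominated_convergence (fun ω => ‖w ω‖ * ‖w ω‖)
          (fun n => (hre _).1) hi (fun n => Filter.Eventually.of_forall fun ω => ?_)
          (Filter.Eventually.of_forall fun ω => ?_)
        · refine (Complex.abs_re_le_norm _).trans ((quad_norm_le _ _).trans ?_)
          exact mul_le_of_le_one_left (by positivity) (hf.fc_norm hX hs n)
        · have h4 := hac N hN hN0 f hf (w ω)
          have h5 := (tendsto_const_nhds (x := w ω)).inner h4 (𝕜 := ℂ)
          have h6 := (Complex.continuous_re.tendsto _).comp h5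
          simpa [Function.comp_def] using h6
      have h7 := tendsto_nhds_unique t1 t2
      rw [integral_const, smul_eq_mul, mul_one, measureReal_def, Measure.restrict_apply_univ,
        ENNReal.toReal_eq_zero_iff] at h7
      exact h7.resolve_right (measure_ne_top ν N)
    refine Measure.AbsolutelyContinuous.mk fun s hsm hs0 => ?_
    rw [hsm.measure_eq_iSup_isCompact]
    simp only [ENNReal.iSup_eq_zero]
    exact fun K hK hKc => hcl K hKc.isClosed (measure_mono_null hK hs0)
  refine ⟨fun t => (ν.rnDeriv volume t).toReal, Measure.integrable_toReal_rnDeriv.integrableOn,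
    fun f hf => ?_⟩
  rw [h3 f hf]
  have h8 : ∫ t, f t ∂ν = ∫ t in Set.Icc a b, f t ∂ν := by
    rw [Measure.restrict_eq_self_of_ae_mem]
    rw [ae_iff]; exact h2
  rw [h8, ← setIntegral_rnDeriv_smul hνac measurableSet_Icc]
  simp only [smul_eq_mul, mul_comm]

theorem cont_mul_int {ξ : ℝ → ℂ} (hξ : IntegrableOn ξ (Set.Icc a b)) {f : ℝ → ℂ}
    (hf : Continuous f) : IntegrableOn (fun t => f t * ξ t) (Set.Icc a b) :=
  hξ.continuousOn_mul hf.continuousOn isCompact_Icc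

theorem quad_density_complex (hX : IsSelfAdjoint X) (hab : a ≤ b) (hs : spectrum ℝ X ⊆ Set.Icc a b)
    (hac : AC X) {w : Ω → H} (hw : AEStronglyMeasurable w μ)
    (hi : Integrable (fun ω => ‖w ω‖ * ‖w ω‖) μ) :
    ∃ r : ℝ → ℂ, IntegrableOn r (Set.Icc a b) ∧ ∀ f : ℝ → ℂ, Continuous f →
      ∫ ω, ⟪w ω, fc f X (w ω)⟫_ℂ ∂μ = ∫ t in Set.Icc a b, f t * r t := by
  obtain ⟨r, hr, h⟩ := quad_density hX hab hs hac hw hi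
  have hr' : IntegrableOn (fun t => (r t : ℂ)) (Set.Icc a b) := hr.ofReal
  refine ⟨fun t => (r t : ℂ), hr', fun f hf => ?_⟩
  have key : ∀ g : ℝ → ℝ, Continuous g → ∫ ω, ⟪w ω, fc (fun t => (g t : ℂ)) X (w ω)⟫_ℂ ∂μ =
      ∫ t in Set.Icc a b, (g t : ℂ) * (r t : ℂ) := by
    intro g hg
    have e1 : ∀ ω, ⟪w ω, fc (fun t => (g t : ℂ)) X (w ω)⟫_ℂ =
        (((⟪w ω, fc (fun t => (g t : ℂ)) X (w ω)⟫_ℂ).re : ℝ) : ℂ) := fun ω =>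
      Complex.ext (by simp) (by rw [fc_real_im]; simp)
    rw [integral_congr_ae (Filter.Eventually.of_forall e1), integral_complex_ofReal]
    simp only [← Complex.ofReal_mul]
    rw [integral_complex_ofReal, h g hg]
  have c1 : Continuous fun t => (f t).re := Complex.continuous_re.comp hf
  have c2 : Continuous fun t => (f t).im := Complex.continuous_im.comp hf
  have e2 : fc f X = fc (fun t => ((f t).re : ℂ)) X + Complex.I • fc (fun t => ((f t).im : ℂ)) X := by
    rw [← fc_const_mul _ (by fun_prop), ← fc_add (by fun_prop) (by fun_prop)]
    congr 1; ext t; rw [mul_comm]; exact (Complex.re_add_im _).symm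
  simp only [e2, add_apply, smul_apply, inner_add_right, inner_smul_right]
  rw [integral_add (quad_int hw hi _) ((quad_int hw hi _).const_mul _), integral_const_mul,
    key _ c1, key _ c2, ← integral_const_mul, ← integral_add]
  · refine integral_congr_ae (Filter.Eventually.of_forall fun t => ?_)
    dsimp only
    rw [← mul_assoc, ← add_mul]
    congr 1; rw [mul_comm Complex.I]; exact Complex.re_add_im _
  · exact cont_mul_int hr' (by fun_prop)
  · exact (cont_mul_int hr' (by fun_prop)).const_mul _

theorem Rep.normalize {u v : Ω → H} {A : H →L[ℂ] H} (h : Rep μ u v A) :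
    ∃ u' v' : Ω → H, AEStronglyMeasurable u' μ ∧ AEStronglyMeasurable v' μ ∧
      Integrable (fun ω => ‖u' ω‖ * ‖u' ω‖) μ ∧ Integrable (fun ω => ‖v' ω‖ * ‖v' ω‖) μ ∧
      ∀ (T : H →L[ℂ] H) ω, ⟪v ω, T (u ω)⟫_ℂ = ⟪v' ω, T (u' ω)⟫_ℂ := by
  set k : Ω → ℝ := fun ω => Real.sqrt (‖v ω‖ / ‖u ω‖) with hk
  have hkm : AEStronglyMeasurable k μ :=
    (Real.continuous_sqrt.measurable.comp_aemeasurable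
      (h.hv.norm.aemeasurable.div h.hu.norm.aemeasurable)).aestronglyMeasurable
  have hkm' : AEStronglyMeasurable (fun ω => (k ω)⁻¹) μ := hkm.aemeasurable.inv.aestronglyMeasurable
  have hk2 : ∀ ω, k ω * k ω = ‖v ω‖ / ‖u ω‖ := fun ω => Real.mul_self_sqrt (by positivity)
  have hk0 : ∀ ω, 0 ≤ k ω := fun ω => Real.sqrt_nonneg _
  refine ⟨fun ω => k ω • u ω, fun ω => (k ω)⁻¹ • v ω, hkm.smul h.hu, hkm'.smul h.hv, ?_, ?_, ?_⟩
  · refine h.int.congr (Filter.Eventually.of_forall fun ω => ?_)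
    dsimp only
    rw [norm_smul, Real.norm_of_nonneg (hk0 ω)]
    rw [mul_mul_mul_comm, hk2]
    by_cases h0 : ‖u ω‖ = 0
    · simp [h0]
    · field_simp
  · refine h.int.congr (Filter.Eventually.of_forall fun ω => ?_)
    dsimp only
    rw [norm_smul, Real.norm_of_nonneg (inv_nonneg.2 (hk0 ω))]
    rw [mul_mul_mul_comm, ← mul_inv, hk2]
    by_cases h0 : ‖v ω‖ = 0
    · simp [h0]
    · field_simp
  · intro T ω
    by_cases h1 : u ω = 0
    · simp [h1]
    by_cases h2 : v ω = 0
    · simp [h2]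
    have : k ω ≠ 0 := by
      intro h0
      have := hk2 ω
      rw [h0, zero_mul, eq_comm, div_eq_zero_iff] at this
      simp [h1, h2] at this
    simp only [← Complex.coe_smul, map_smul, inner_smul_left, inner_smul_right,
      Complex.conj_ofReal]
    rw [← mul_assoc, ← Complex.ofReal_mul, mul_inv_cancel₀ this]
    simp

theorem integral_four {f1 f2 f3 f4 : Ω → ℂ} (h1 : Integrable f1 μ) (h2 : Integrable f2 μ)
    (h3 : Integrable f3 μ) (h4 : Integrable f4 μ) {c1 c2 c3 c4 : ℂ} :
    ∫ ω, (c1 * f1 ω + c2 * f2 ω + c3 * f3 ω + c4 * f4 ω) ∂μ =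
      c1 * ∫ ω, f1 ω ∂μ + c2 * ∫ ω, f2 ω ∂μ + c3 * ∫ ω, f3 ω ∂μ + c4 * ∫ ω, f4 ω ∂μ := by
  have I1 := h1.const_mul c1
  have I2 := h2.const_mul c2
  have I3 := h3.const_mul c3
  have I4 := h4.const_mul c4
  have I12 : Integrable (fun ω => c1 * f1 ω + c2 * f2 ω) μ := I1.add I2
  have I123 : Integrable (fun ω => c1 * f1 ω + c2 * f2 ω + c3 * f3 ω) μ := I12.add I3
  rw [integral_add I123 I4, integral_add I12 I3, integral_add I1 I2]
  simp only [integral_const_mul]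

theorem nuc_density (hX : IsSelfAdjoint X) (hab : a ≤ b) (hs : spectrum ℝ X ⊆ Set.Icc a b)
    (hac : AC X) {K : H →L[ℂ] H} (hK : IsNuc K) {ι : Type*} (e : HilbertBasis ι ℂ H) :
    ∃ r : ℝ → ℂ, IntegrableOn r (Set.Icc a b) ∧ ∀ f : ℝ → ℂ, Continuous f →
      trace e (fc f X * K) = ∫ t in Set.Icc a b, f t * r t := by
  obtain ⟨Ω, m, μ, u, v, hsf, h⟩ := hK
  obtain ⟨u', v', hu, hv, iu, iv, huv⟩ := h.normalize
  have hm : ∀ c : ℂ, AEStronglyMeasurable (fun ω => v' ω + c • u' ω) μ := fun c =>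
    hv.add (hu.const_smul c)
  have hi : ∀ c : ℂ, Integrable (fun ω => ‖v' ω + c • u' ω‖ * ‖v' ω + c • u' ω‖) μ := by
    intro c
    refine ((iv.const_mul 2).add (iu.const_mul (2 * ‖c‖ ^ 2))).mono' ((hm c).norm.mul (hm c).norm)
      (Filter.Eventually.of_forall fun ω => ?_)
    rw [Real.norm_of_nonneg (by positivity)]
    have h1 : ‖v' ω + c • u' ω‖ ≤ ‖v' ω‖ + ‖c‖ * ‖u' ω‖ := by
      rw [← norm_smul]; exact norm_add_le _ _
    have h2 := mul_self_le_mul_self (norm_nonneg _) h1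
    simp only [Pi.add_apply]
    nlinarith [sq_nonneg (‖v' ω‖ - ‖c‖ * ‖u' ω‖)]
  have hq := fun c : ℂ => quad_density_complex hX hab hs hac (hm c) (hi c)
  obtain ⟨r1, i1, h1⟩ := hq 1
  obtain ⟨r2, i2, h2⟩ := hq (-1)
  obtain ⟨r3, i3, h3⟩ := hq Complex.I
  obtain ⟨r4, i4, h4⟩ := hq (-Complex.I)
  refine ⟨fun t => (1 / 4) * r1 t + (-1 / 4) * r2 t + (-Complex.I / 4) * r3 t +
    (Complex.I / 4) * r4 t, (((i1.const_mul _).add (i2.const_mul _)).add (i3.const_mul _)).add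
      (i4.const_mul _), fun f hf => ?_⟩
  rw [(h.left (fc f X)).trace_eq e]
  have pol : ∀ ω, ⟪v ω, fc f X (u ω)⟫_ℂ =
      (1 / 4) * ⟪v' ω + (1 : ℂ) • u' ω, fc f X (v' ω + (1 : ℂ) • u' ω)⟫_ℂ +
      (-1 / 4) * ⟪v' ω + (-1 : ℂ) • u' ω, fc f X (v' ω + (-1 : ℂ) • u' ω)⟫_ℂ +
      (-Complex.I / 4) * ⟪v' ω + Complex.I • u' ω, fc f X (v' ω + Complex.I • u' ω)⟫_ℂ +
      (Complex.I / 4) * ⟪v' ω + (-Complex.I) • u' ω, fc f X (v' ω + (-Complex.I) • u' ω)⟫_ℂ := by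
    intro ω
    rw [huv]
    simp only [map_add, map_smul, inner_add_left, inner_add_right, inner_smul_left,
      inner_smul_right, map_neg, map_one, Complex.conj_I]
    linear_combination (⟪v' ω, fc f X (u' ω)⟫_ℂ / 2 - ⟪u' ω, fc f X (v' ω)⟫_ℂ / 2) * Complex.I_sq
  rw [integral_congr_ae (Filter.Eventually.of_forall pol)]
  have q := fun c => quad_int (hm c) (hi c) (fc f X)
  rw [integral_four (q 1) (q (-1)) (q Complex.I) (q (-Complex.I)), h1 f hf, h2 f hf, h3 f hf,
    h4 f hf, ← integral_four (cont_mul_int i1 hf) (cont_mul_int i2 hf) (cont_mul_int i3 hf)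
    (cont_mul_int i4 hf)]
  refine integral_congr_ae (Filter.Eventually.of_forall fun t => ?_)
  dsimp only
  ring

end density

/-! ### Recovering a density from its integrals against continuous functions -/

section recover
variable {a b : ℝ}

theorem exists_cont_seq {ν : Measure ℝ} [IsFiniteMeasure ν] {g : ℝ → ℂ}
    (hg : Integrable g ν) :
    ∃ f : ℕ → ℝ → ℂ, (∀ n, Continuous (f n)) ∧
      ∀ᵐ t ∂ν, Filter.Tendsto (fun n => f n t) Filter.atTop (nhds (g t)) := by
  have hm : MemLp g 1 ν := memLp_one_iff_integrable.2 hg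
  have h1 : ∀ n : ℕ, ∃ f : BoundedContinuousFunction ℝ ℂ,
      eLpNorm (g - ⇑f) 1 ν ≤ ((n : ENNReal) + 1)⁻¹ := fun n => by
    obtain ⟨f, hf, -⟩ := hm.exists_boundedContinuous_eLpNorm_sub_le ENNReal.one_ne_top
      (ε := ((n : ENNReal) + 1)⁻¹) (by simp)
    exact ⟨f, hf⟩
  choose f hf using h1
  have h2 : TendstoInMeasure ν (fun n => (f n : ℝ → ℂ)) Filter.atTop g := by
    refine tendstoInMeasure_of_tendsto_eLpNorm one_ne_zero
      (fun n => (f n).continuous.aestronglyMeasurable) hg.1 ?_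
    refine tendsto_of_tendsto_of_tendsto_of_le_of_le tendsto_const_nhds
      (h := fun n : ℕ => ((n : ENNReal) + 1)⁻¹) ?_ (fun n => zero_le)
      (fun n => by rw [eLpNorm_sub_comm]; exact hf n)
    have := (ENNReal.tendsto_inv_nat_nhds_zero).comp (Filter.tendsto_add_atTop_nat 1)
    refine this.congr fun n => ?_
    simp
  obtain ⟨ns, -, h3⟩ := h2.exists_seq_tendsto_ae
  exact ⟨fun n => f (ns n), fun n => (f (ns n)).continuous, h3⟩

theorem exists_cont_indicator (a b : ℝ) {s : Set ℝ} (hs : MeasurableSet s) :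
    ∃ f : ℕ → ℝ → ℝ, (∀ n, Continuous (f n)) ∧ (∀ n t, 0 ≤ f n t) ∧ (∀ n t, f n t ≤ 1) ∧
      ∀ᵐ t ∂(volume.restrict (Set.Icc a b)), Filter.Tendsto (fun n => f n t) Filter.atTop
        (nhds (s.indicator (fun _ => 1) t)) := by
  have hg : Integrable (s.indicator (fun _ => (1 : ℂ))) (volume.restrict (Set.Icc a b)) :=
    (integrable_const _).indicator hs
  obtain ⟨f, hf, hl⟩ := exists_cont_seq hg
  refine ⟨fun n t => max 0 (min 1 (f n t).re), fun n => ?_, fun n t => le_max_left _ _,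
    fun n t => max_le zero_le_one (min_le_left _ _), ?_⟩
  · have := Complex.continuous_re.comp (hf n)
    exact continuous_const.max (continuous_const.min this)
  · filter_upwards [hl] with t ht
    have h1 := (tendsto_const_nhds (x := (0 : ℝ))).max ((tendsto_const_nhds (x := (1 : ℝ))).min
      ((Complex.continuous_re.tendsto _).comp ht))
    by_cases hts : t ∈ s <;> simpa [hts, Function.comp_def] using h1

theorem tendsto_int_mul {ξ : ℝ → ℂ} (hξ : IntegrableOn ξ (Set.Icc a b)) {f : ℕ → ℝ → ℂ}
    {g : ℝ → ℂ} {C : ℝ} (hf : ∀ n, Continuous (f n))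
    (h1 : ∀ n, ∀ t ∈ Set.Icc a b, ‖f n t‖ ≤ C)
    (hl : ∀ᵐ t ∂(volume.restrict (Set.Icc a b)),
      Filter.Tendsto (fun n => f n t) Filter.atTop (nhds (g t))) :
    Filter.Tendsto (fun n => ∫ t in Set.Icc a b, f n t * ξ t) Filter.atTop
      (nhds (∫ t in Set.Icc a b, g t * ξ t)) := by
  refine tendsto_integral_of_dominated_convergence (fun t => C * ‖ξ t‖)
    (fun n => (cont_mul_int hξ (hf n)).1) (hξ.norm.const_mul C) (fun n => ?_) ?_
  · filter_upwards [ae_restrict_mem measurableSet_Icc] with t ht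
    rw [norm_mul]; exact mul_le_mul_of_nonneg_right (h1 n t ht) (norm_nonneg _)
  · filter_upwards [hl] with t ht
    exact ht.mul_const _

theorem norm_bound_of_cont {ξ : ℝ → ℂ} (hξ : IntegrableOn ξ (Set.Icc a b)) {C : ℝ}
    (h : ∀ f : ℝ → ℂ, Continuous f → (∀ t, ‖f t‖ ≤ 1) →
      ‖∫ t in Set.Icc a b, f t * ξ t‖ ≤ C) :
    ∫ t in Set.Icc a b, ‖ξ t‖ ≤ C := by
  set g : ℝ → ℂ := fun t => star (ξ t) / ‖ξ t‖ with hg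
  have hg1 : ∀ t, ‖g t‖ ≤ 1 := fun t => by
    rw [hg]; dsimp only
    rw [norm_div, norm_star, Complex.norm_real, norm_norm]
    exact div_self_le_one _
  have hgm : AEStronglyMeasurable g (volume.restrict (Set.Icc a b)) := by
    have h1 := hξ.1.aemeasurable
    exact ((continuous_star.measurable.comp_aemeasurable h1).div
      (Complex.measurable_ofReal.comp_aemeasurable h1.norm)).aestronglyMeasurable
  have hgi : Integrable g (volume.restrict (Set.Icc a b)) :=
    Integrable.mono' (integrable_const (1 : ℝ)) hgm (Filter.Eventually.of_forall hg1)
  obtain ⟨f, hf, hl⟩ := exists_cont_seq hgi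
  have hpos : ∀ z : ℂ, (0 : ℝ) < max 1 ‖z‖ := fun z => lt_max_of_lt_left one_pos
  set R : ℂ → ℂ := fun z => ((max 1 ‖z‖)⁻¹ : ℝ) • z with hR
  have hRc : Continuous R := by
    refine Continuous.smul (Continuous.inv₀ (by fun_prop) fun z => (hpos z).ne') continuous_id
  have hR1 : ∀ z, ‖R z‖ ≤ 1 := fun z => by
    rw [hR]; dsimp only
    rw [norm_smul, norm_inv, Real.norm_of_nonneg (hpos z).le, inv_mul_le_iff₀ (hpos z), mul_one]
    exact le_max_right _ _
  have hRg : ∀ t, R (g t) = g t := fun t => by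
    rw [hR]; dsimp only; rw [max_eq_left (hg1 t)]; simp
  have hl' : ∀ᵐ t ∂(volume.restrict (Set.Icc a b)),
      Filter.Tendsto (fun n => R (f n t)) Filter.atTop (nhds (g t)) := by
    filter_upwards [hl] with t ht
    have := (hRc.tendsto (g t)).comp ht
    rw [hRg] at this
    exact this
  have h2 := tendsto_int_mul hξ (f := fun n t => R (f n t)) (fun n => hRc.comp (hf n))
    (fun n t _ => hR1 _) hl'
  have h3 := le_of_tendsto h2.norm (Filter.Eventually.of_forall fun n =>
    h _ (hRc.comp (hf n)) (fun t => hR1 _))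
  have h4 : ∀ t, g t * ξ t = ((‖ξ t‖ : ℝ) : ℂ) := fun t => by
    rw [hg]; dsimp only
    rw [div_mul_eq_mul_div, Complex.star_def, ← Complex.normSq_eq_conj_mul_self,
      Complex.normSq_eq_norm_sq]
    by_cases h0 : ξ t = 0
    · simp [h0]
    · have : (‖ξ t‖ : ℂ) ≠ 0 := by simpa using h0
      push_cast; field_simp
  rw [integral_congr_ae (Filter.Eventually.of_forall h4), integral_complex_ofReal,
    Complex.norm_real] at h3
  exact (le_abs_self _).trans h3

theorem ae_zero_of_cont {ξ : ℝ → ℂ} (hξ : IntegrableOn ξ (Set.Icc a b))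
    (h : ∀ f : ℝ → ℂ, Continuous f → ∫ t in Set.Icc a b, f t * ξ t = 0) :
    ∀ᵐ t ∂(volume : Measure ℝ), t ∈ Set.Icc a b → ξ t = 0 := by
  have h1 := norm_bound_of_cont hξ (C := 0) (fun f hf _ => by rw [h f hf, norm_zero])
  have h2 : ∫ t in Set.Icc a b, ‖ξ t‖ = 0 := le_antisymm h1 (integral_nonneg fun t => norm_nonneg _)
  rw [integral_eq_zero_iff_of_nonneg (fun t => norm_nonneg _) hξ.norm] at h2
  rw [← ae_restrict_iff' measurableSet_Icc]
  filter_upwards [h2] with t ht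
  simpa using ht

/-- the complex number `z` is real and nonnegative -/
def NN (z : ℂ) : Prop := z.im = 0 ∧ 0 ≤ z.re

theorem NN.closed : IsClosed {z : ℂ | NN z} :=
  (isClosed_eq Complex.continuous_im continuous_const).inter
    (isClosed_le continuous_const Complex.continuous_re)

theorem ae_nonneg_of_sets {ξ : ℝ → ℂ} (hξ : IntegrableOn ξ (Set.Icc a b))
    (h : ∀ s : Set ℝ, MeasurableSet s →
      NN (∫ t in Set.Icc a b, s.indicator (fun _ => (1 : ℂ)) t * ξ t)) :
    ∀ᵐ t ∂(volume.restrict (Set.Icc a b)), NN (ξ t) := by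
  have h0 : ∀ s : Set ℝ, MeasurableSet s → (∫ t in Set.Icc a b, s.indicator (fun _ => (1 : ℂ)) t * ξ t) =
      ∫ t in s, ξ t ∂(volume.restrict (Set.Icc a b)) := by
    intro s hs
    rw [← integral_indicator hs]
    refine integral_congr_ae (Filter.Eventually.of_forall fun t => ?_)
    by_cases ht : t ∈ s <;> simp [ht]
  have hr : ∀ s : Set ℝ, (∫ t in s, ξ t ∂(volume.restrict (Set.Icc a b))).re =
      ∫ t in s, (ξ t).re ∂(volume.restrict (Set.Icc a b)) := fun s =>
    (integral_re (𝕜 := ℂ) (Integrable.restrict hξ)).symm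
  have hi : ∀ s : Set ℝ, (∫ t in s, ξ t ∂(volume.restrict (Set.Icc a b))).im =
      ∫ t in s, (ξ t).im ∂(volume.restrict (Set.Icc a b)) := fun s =>
    (integral_im (𝕜 := ℂ) (Integrable.restrict hξ)).symm
  have a1 := ae_nonneg_of_forall_setIntegral_nonneg (f := fun t => (ξ t).re) hξ.re
    (fun s hs _ => by have := (h s hs).2; rwa [h0 s hs, hr] at this)
  have a2 := ae_nonneg_of_forall_setIntegral_nonneg (f := fun t => (ξ t).im) hξ.im
    (fun s hs _ => by have := (h s hs).1; rw [h0 s hs, hi] at this; exact this.ge)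
  have a3 := ae_nonneg_of_forall_setIntegral_nonneg (f := fun t => -(ξ t).im) hξ.im.neg
    (fun s hs _ => by
      have := (h s hs).1; rw [h0 s hs, hi] at this; rw [integral_neg, this, neg_zero])
  filter_upwards [a1, a2, a3] with t h1 h2 h3
  simp only [Pi.zero_apply] at h1 h2 h3
  exact ⟨le_antisymm (by linarith) h2, h1⟩

theorem ae_nonneg_of_cont {ξ : ℝ → ℂ} (hξ : IntegrableOn ξ (Set.Icc a b))
    (h : ∀ f : ℝ → ℝ, Continuous f → (∀ t, 0 ≤ f t) → (∀ t, f t ≤ 1) →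
      NN (∫ t in Set.Icc a b, (f t : ℂ) * ξ t)) :
    ∀ᵐ t ∂(volume.restrict (Set.Icc a b)), NN (ξ t) := by
  refine ae_nonneg_of_sets hξ fun s hs => ?_
  obtain ⟨f, h1, h2, h3, h4⟩ := exists_cont_indicator a b hs
  have h5 := tendsto_int_mul hξ (f := fun n t => (f n t : ℂ)) (g := s.indicator (fun _ => (1 : ℂ)))
    (fun n => Complex.continuous_ofReal.comp (h1 n))
    (fun n t _ => by rw [Complex.norm_real, Real.norm_of_nonneg (h2 n t)]; exact h3 n t) (by
      filter_upwards [h4] with t ht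
      have := (Complex.continuous_ofReal.tendsto _).comp ht
      by_cases hts : t ∈ s <;> simpa [hts, Function.comp_def] using this)
  exact NN.closed.mem_of_tendsto h5 (Filter.Eventually.of_forall fun n =>
    h (f n) (h1 n) (h2 n) (h3 n))

end recover

/-! ### Positivity -/

theorem NN.add {z w : ℂ} (hz : NN z) (hw : NN w) : NN (z + w) :=
  ⟨by rw [Complex.add_im, hz.1, hw.1, add_zero], add_nonneg hz.2 hw.2⟩

section positivity
variable {X W D2 : H →L[ℂ] H} {a b c : ℝ} {ι : Type*} (e : HilbertBasis ι ℂ H)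

theorem pow_nuc {G W : H →L[ℂ] H} (hG : IsNuc (G * W - W * G)) (n : ℕ) :
    IsNuc ((G * W * G) ^ n - G ^ (2 * n) * W ^ n) := by
  have hc : ∀ n, IsNuc (W ^ n * G - G * W ^ n) := fun n => by
    rw [← neg_sub]
    obtain ⟨w, -⟩ := exists_hilbertBasis ℂ H
    obtain ⟨e, -⟩ := (exists_hilbertBasis ℂ H).choose_spec
    exact (comm_pow e hG n).1.neg
  induction n with
  | zero => simpa using IsNuc.zero
  | succ n ih =>
    have h1 : (G * W * G) ^ (n + 1) - G ^ (2 * (n + 1)) * W ^ (n + 1) =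
        ((G * W * G) ^ n - G ^ (2 * n) * W ^ n) * (G * W * G) +
        G ^ (2 * n) * ((W ^ n * G - G * W ^ n) * (W * G)) +
        G ^ (2 * n + 1) * (W ^ (n + 1) * G - G * W ^ (n + 1)) := by
      have e1 : G ^ (2 * (n + 1)) = G ^ (2 * n) * G * G := by
        rw [mul_add, pow_add]; simp [pow_two, mul_assoc]
      rw [e1, pow_succ (G * W * G), pow_succ G, pow_succ W]
      noncomm_ring
    rw [h1]
    exact ((ih.right _).add (((hc n).right _).left _)).add ((hc (n + 1)).left _)

theorem tr_neg (A : H →L[ℂ] H) : trace e (-A) = -trace e A := by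
  have := tr_smul e (-1) A
  rwa [neg_one_smul, neg_one_mul] at this

theorem trace_comm_eq {R K X : H →L[ℂ] H} (h : IsNuc (R - K)) (hK : IsNuc (K * X - X * K)) :
    trace e (R * X - X * R) = trace e (K * X - X * K) := by
  have h1 : R * X - X * R = ((R - K) * X - X * (R - K)) + (K * X - X * K) := by noncomm_ring
  rw [h1, tr_add e ((h.right X).sub (h.left X)) hK, tr_sub e (h.right X) (h.left X),
    tr_comm e h X, sub_self, zero_add]

theorem aeval_map_real (Z : H →L[ℂ] H) (q : ℝ[X]) :
    aeval Z (q.map (algebraMap ℝ ℂ)) =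
      ∑ n ∈ Finset.range (q.natDegree + 1), ((q.coeff n : ℝ) : ℂ) • Z ^ n := by
  rw [aeval_eq_sum_range' (n := q.natDegree + 1)]
  · simp
  · exact Nat.lt_succ_of_le natDegree_map_le

theorem pos_first (hX : IsSelfAdjoint X) (hs : spectrum ℝ X ⊆ Set.Icc a b)
    (hW : IsSelfAdjoint W) (hc : 0 ≤ c) (hsW : spectrum ℝ W ⊆ Set.Icc 0 c)
    (hD : D2 = (-Complex.I) • (W * X - X * W))
    {Ω : Type} [MeasurableSpace Ω] {μ : Measure Ω} [SFinite μ] {u : Ω → H} (hrep : Rep μ u u D2)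
    {q : ℝ[X]} (hq : ∀ t ∈ Set.Icc 0 c, 0 ≤ q.derivative.eval t)
    {h : ℝ[X]} (hh : ∀ t ∈ Set.Icc a b, |h.eval t| ≤ 1) :
    NN (∑ n ∈ Finset.range (q.natDegree + 1), ((q.coeff n : ℝ) : ℂ) *
      trace e (fc (fun t => (((h.eval t) ^ (2 * n) : ℝ) : ℂ)) X *
        ((-Complex.I) • (W ^ n * X - X * W ^ n)))) := by
  have hDn : IsNuc D2 := ⟨Ω, _, μ, u, u, inferInstance, hrep⟩
  have hWX : W * X - X * W = Complex.I • D2 := by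
    rw [hD, smul_smul]; simp
  have hWXn : IsNuc (W * X - X * W) := by rw [hWX]; exact hDn.smul _
  have hXWn : IsNuc (X * W - W * X) := by rw [← neg_sub]; exact hWXn.neg
  set G := fc (fun t => ((h.eval t : ℝ) : ℂ)) X with hG
  have hGp : G = aeval X (h.map (algebraMap ℝ ℂ)) := by
    rw [← fc_poly hX, hG]; congr 1; ext t; rw [eval_map_ofReal]
  have hGa : IsSelfAdjoint G := fc_selfAdjoint _
  have hGX : G * X = X * G := by
    have := fc_comm (A := X) (fun t => ((h.eval t : ℝ) : ℂ)) (fun t => (t : ℂ))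
    rw [fc_id hX] at this; exact this.eq
  have hGn : ‖G‖ ≤ 1 := fc_norm_le hX hs zero_le_one fun t ht => by
    rw [Complex.norm_real]; exact hh t ht
  have hGW : IsNuc (G * W - W * G) := by
    rw [← neg_sub, hGp]; exact (comm_poly e hWXn _).1.neg
  have hGpow : ∀ n, fc (fun t => (((h.eval t) ^ n : ℝ) : ℂ)) X = G ^ n := by
    intro n
    induction n with
    | zero => simpa using fc_one hX
    | succ n ih =>
      rw [pow_succ, ← ih, hG, ← fc_mul (by fun_prop) (by fun_prop)]
      congr 1; ext t; push_cast; ring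
  -- the compressed operator
  set Z := G * W * G with hZ
  have hZa : IsSelfAdjoint Z := by
    have := hW.conjugate' G
    rwa [hGa.star_eq] at this
  have hWpos : ∀ x, 0 ≤ (⟪x, W x⟫_ℂ).re := fun x => by
    have := fc_pos hW hsW (f := fun t => t) continuous_id (fun t ht => ht.1) x
    rwa [fc_id hW] at this
  have hWn : ‖W‖ ≤ c := by
    have := fc_norm_le hW hsW (f := fun t => (t : ℂ)) hc (fun t ht => by
      rw [Complex.norm_real, Real.norm_of_nonneg ht.1]; exact ht.2)
    rwa [fc_id hW] at this
  have hGad : ∀ x y, ⟪x, G y⟫_ℂ = ⟪G x, y⟫_ℂ := fun x y => by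
    conv_rhs => rw [← ContinuousLinearMap.isSelfAdjoint_iff'.1 hGa,
      ContinuousLinearMap.adjoint_inner_left]
  have hZ0 : 0 ≤ Z := by
    rw [ContinuousLinearMap.nonneg_iff_isPositive, ContinuousLinearMap.isPositive_def']
    refine ⟨hZa, fun x => ?_⟩
    rw [ContinuousLinearMap.reApplyInnerSelf_apply, ← inner_re_symm]
    show 0 ≤ (⟪x, G (W (G x))⟫_ℂ).re
    rw [hGad]; exact hWpos _
  have hZn : ‖Z‖ ≤ c := by
    calc ‖Z‖ ≤ ‖G‖ * ‖W‖ * ‖G‖ := (norm_mul_le _ _).trans (by gcongr; exact norm_mul_le _ _)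
      _ ≤ 1 * c * 1 := by gcongr
      _ = c := by ring
  have hsZ : spectrum ℝ Z ⊆ Set.Icc 0 c := by
    intro t ht
    refine ⟨spectrum_nonneg_of_nonneg hZ0 ht, (le_abs_self t).trans ?_⟩
    refine (spectrum.norm_le_norm_mul_of_mem ht).trans ?_
    calc ‖Z‖ * ‖(1 : H →L[ℂ] H)‖ ≤ c * 1 := by gcongr; exact ContinuousLinearMap.norm_id_le
      _ = c := mul_one c
  have hZX : X * Z - Z * X = (-Complex.I) • (G * D2 * G) := by
    have h1 : X * Z - Z * X = -(G * (W * X - X * W) * G) := by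
      have e1 : X * Z = G * (X * W) * G := by rw [hZ, ← mul_assoc, ← mul_assoc, ← hGX]; noncomm_ring
      have e2 : Z * X = G * (W * X) * G := by rw [hZ, mul_assoc, hGX]; noncomm_ring
      rw [e1, e2]; noncomm_ring
    rw [h1, hWX]; simp
  have hGDG : IsNuc (G * D2 * G) := (hDn.left G).right G
  have hZXn : IsNuc (X * Z - Z * X) := by rw [hZX]; exact hGDG.smul _
  set Q := q.map (algebraMap ℝ ℂ) with hQ
  -- right-hand side
  have hK : ∀ n, IsNuc (W ^ n * X - X * W ^ n) := fun n => by
    rw [← neg_sub]; exact (comm_pow e hXWn n).1.neg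
  have hterm : ∀ n, trace e (Z ^ n * X - X * Z ^ n) =
      trace e (G ^ (2 * n) * (W ^ n * X - X * W ^ n)) := by
    intro n
    have hGnX : G ^ (2 * n) * X = X * G ^ (2 * n) := (Commute.pow_left (show Commute G X from hGX) _).eq
    have h2 : G ^ (2 * n) * W ^ n * X - X * (G ^ (2 * n) * W ^ n) =
        G ^ (2 * n) * (W ^ n * X - X * W ^ n) := by
      rw [← mul_assoc X, ← hGnX]; noncomm_ring
    rw [trace_comm_eq e (pow_nuc hGW n) (by rw [h2]; exact (hK n).left _), h2]
  have hZcn : ∀ n, IsNuc (Z ^ n * X - X * Z ^ n) := fun n => by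
    rw [← neg_sub]; exact (comm_pow e hZXn n).1.neg
  have hsum : ∑ n ∈ Finset.range (q.natDegree + 1), ((q.coeff n : ℝ) : ℂ) *
      trace e (fc (fun t => (((h.eval t) ^ (2 * n) : ℝ) : ℂ)) X *
        ((-Complex.I) • (W ^ n * X - X * W ^ n))) =
      (-Complex.I) * trace e (aeval Z Q * X - X * aeval Z Q) := by
    have h3 : aeval Z Q * X - X * aeval Z Q = ∑ n ∈ Finset.range (q.natDegree + 1),
        ((q.coeff n : ℝ) : ℂ) • (Z ^ n * X - X * Z ^ n) := by
      rw [hQ, aeval_map_real, Finset.sum_mul, Finset.mul_sum, ← Finset.sum_sub_distrib]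
      refine Finset.sum_congr rfl fun n _ => ?_
      rw [smul_mul_assoc, mul_smul_comm, smul_sub]
    rw [h3, tr_sum e _ fun n _ => (hZcn n).smul _, Finset.mul_sum]
    refine Finset.sum_congr rfl fun n _ => ?_
    rw [hGpow, mul_smul_comm, tr_smul, tr_smul, hterm]; ring
  rw [hsum]
  have h4 : (-Complex.I) * trace e (aeval Z Q * X - X * aeval Z Q) =
      trace e (aeval Z (derivative Q) * (G * D2 * G)) := by
    rw [← neg_sub, tr_neg, (comm_poly e hZXn Q).2, hZX, mul_smul_comm, tr_smul]
    linear_combination (-trace e (aeval Z (derivative Q) * (G * D2 * G))) * Complex.I_sq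
  have h5 : trace e (aeval Z (derivative Q) * (G * D2 * G)) =
      trace e (G * aeval Z (derivative Q) * G * D2) := by
    have := tr_comm e ((hDn.left G).left (aeval Z (derivative Q))) G
    rw [← mul_assoc, ← mul_assoc] at this ⊢
    rw [this]; congr 1
  have h6 : aeval Z (derivative Q) = fc (fun t => ((q.derivative.eval t : ℝ) : ℂ)) Z := by
    rw [← fc_poly hZa, hQ, derivative_map]; congr 1; ext t; rw [eval_map_ofReal]
  rw [h4, h5, (hrep.left _).trace_eq e, h6]
  have h7 : ∀ ω, ⟪u ω, (G * fc (fun t => ((q.derivative.eval t : ℝ) : ℂ)) Z * G) (u ω)⟫_ℂ =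
      (((⟪G (u ω), fc (fun t => ((q.derivative.eval t : ℝ) : ℂ)) Z (G (u ω))⟫_ℂ).re : ℝ) : ℂ) := by
    intro ω
    have : ⟪u ω, (G * fc (fun t => ((q.derivative.eval t : ℝ) : ℂ)) Z * G) (u ω)⟫_ℂ =
      ⟪G (u ω), fc (fun t => ((q.derivative.eval t : ℝ) : ℂ)) Z (G (u ω))⟫_ℂ := hGad _ _
    rw [this]
    exact Complex.ext (by simp) (by rw [fc_real_im]; simp)
  rw [integral_congr_ae (Filter.Eventually.of_forall h7), integral_complex_ofReal]
  refine ⟨Complex.ofReal_im _, ?_⟩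
  rw [Complex.ofReal_re]
  exact integral_nonneg fun ω => fc_pos hZa hsZ (by fun_prop) hq _

theorem weier_one (a b : ℝ) {f : ℝ → ℝ} (hf : Continuous f) (h0 : ∀ t, 0 ≤ f t)
    (h1 : ∀ t, f t ≤ 1) (n : ℕ) :
    ∃ p : ℝ[X], ∀ t ∈ Set.Icc a b, |p.eval t| ≤ 1 ∧ |p.eval t - f t| ≤ 2 / ((n : ℝ) + 1) := by
  have hn : (0 : ℝ) < 1 / ((n : ℝ) + 1) := by positivity
  have hn1 : 1 / ((n : ℝ) + 1) ≤ 1 := by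
    rw [div_le_one (by positivity)]; linarith [Nat.cast_nonneg (α := ℝ) n]
  set ε := 1 / ((n : ℝ) + 1) with hε
  obtain ⟨p, hp⟩ := weierstrass_real (f := fun t => (1 - ε) * f t) (by fun_prop) a b hn
  refine ⟨p, fun t ht => ?_⟩
  have h2 := abs_lt.1 (hp t ht)
  have h3 : (2 : ℝ) / ((n : ℝ) + 1) = 2 * ε := by rw [hε]; ring
  rw [h3, abs_le, abs_le]
  have h4 : ε * f t ≤ ε := mul_le_of_le_one_right hn.le (h1 t)
  have h5 : 0 ≤ ε * f t := mul_nonneg hn.le (h0 t)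
  have h6 := h0 t
  have h7 := h1 t
  have h8 : 0 ≤ (1 - ε) * f t := mul_nonneg (by linarith) h6
  have h9 : (1 - ε) * f t ≤ 1 - ε := mul_le_of_le_one_right (by linarith) h7
  refine ⟨⟨?_, ?_⟩, ?_, ?_⟩ <;> nlinarith

theorem pos_second (hX : IsSelfAdjoint X) (hab : a ≤ b) (hs : spectrum ℝ X ⊆ Set.Icc a b)
    (hac : AC X)
    (hW : IsSelfAdjoint W) (hc : 0 ≤ c) (hsW : spectrum ℝ W ⊆ Set.Icc 0 c)
    (hD : D2 = (-Complex.I) • (W * X - X * W))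
    {Ω : Type} [MeasurableSpace Ω] {μ : Measure Ω} [SFinite μ] {u : Ω → H} (hrep : Rep μ u u D2)
    {q : ℝ[X]} (hq : ∀ t ∈ Set.Icc 0 c, 0 ≤ q.derivative.eval t)
    {f : ℝ → ℝ} (hf : Continuous f) (hf0 : ∀ t ∈ Set.Icc a b, 0 ≤ f t) :
    NN (trace e (fc (fun t => (f t : ℂ)) X * ((-Complex.I) •
      (aeval W (q.map (algebraMap ℝ ℂ)) * X - X * aeval W (q.map (algebraMap ℝ ℂ)))))) := by
  have hDn : IsNuc D2 := ⟨Ω, _, μ, u, u, inferInstance, hrep⟩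
  have hWX : W * X - X * W = Complex.I • D2 := by
    rw [hD, smul_smul]; simp
  have hWXn : IsNuc (W * X - X * W) := by rw [hWX]; exact hDn.smul _
  have hXWn : IsNuc (X * W - W * X) := by rw [← neg_sub]; exact hWXn.neg
  have hK : ∀ n, IsNuc ((-Complex.I) • (W ^ n * X - X * W ^ n)) := fun n => by
    rw [← neg_sub]; exact (comm_pow e hXWn n).1.neg.smul _
  have hξ : ∀ n, ∃ r : ℝ → ℂ, IntegrableOn r (Set.Icc a b) ∧ (∀ f : ℝ → ℂ, Continuous f →
      trace e (fc f X * ((-Complex.I) • (W ^ n * X - X * W ^ n))) = ∫ t in Set.Icc a b, f t * r t) ∧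
      (n = 0 → r = 0) := by
    intro n
    by_cases hn : n = 0
    · refine ⟨0, integrableOn_zero, fun f hf => ?_, fun _ => rfl⟩
      subst hn
      simp [tr_zero]
    · obtain ⟨r, h1, h2⟩ := nuc_density hX hab hs hac (hK n) e
      exact ⟨r, h1, h2, fun h => absurd h hn⟩
  choose ξ hξi hξt hξ0 using hξ
  set F : ℝ → ℂ := fun t => ∑ n ∈ Finset.range (q.natDegree + 1), ((q.coeff n : ℝ) : ℂ) * ξ n t
    with hF
  have hFi : IntegrableOn F (Set.Icc a b) :=
    integrable_finsetSum _ fun n _ => (hξi n).const_mul _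
  have hFint : ∀ g : ℝ → ℂ, (∀ n, IntegrableOn (fun t => g t * ξ n t) (Set.Icc a b)) →
      ∫ t in Set.Icc a b, g t * F t = ∑ n ∈ Finset.range (q.natDegree + 1),
        ((q.coeff n : ℝ) : ℂ) * ∫ t in Set.Icc a b, g t * ξ n t := by
    intro g hg
    simp only [← integral_const_mul]
    rw [← integral_finsetSum _ fun n _ => (hg n).const_mul _]
    refine integral_congr_ae (Filter.Eventually.of_forall fun t => ?_)
    dsimp only [F]
    rw [Finset.mul_sum]
    exact Finset.sum_congr rfl fun n _ => by ring
  have hFpos : ∀ᵐ t ∂(volume.restrict (Set.Icc a b)), NN (F t) := by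
    refine ae_nonneg_of_sets hFi fun s hsm => ?_
    obtain ⟨g, g1, g2, g3, g4⟩ := exists_cont_indicator a b hsm
    choose p hp using fun n => weier_one a b (g1 n) (g2 n) (g3 n) n
    have hpl : ∀ᵐ t ∂(volume.restrict (Set.Icc a b)), Filter.Tendsto (fun n => (p n).eval t)
        Filter.atTop (nhds (s.indicator (fun _ => 1) t)) := by
      filter_upwards [g4, ae_restrict_mem measurableSet_Icc] with t ht hti
      have h1 : Filter.Tendsto (fun n => (p n).eval t - g n t) Filter.atTop (nhds 0) := by
        refine squeeze_zero_norm (fun n => (hp n t hti).2) ?_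
        have := (tendsto_one_div_add_atTop_nhds_zero_nat (𝕜 := ℝ)).const_mul 2
        simpa [div_eq_mul_inv] using this
      simpa using h1.add ht
    have huint : ∀ n, IntegrableOn (fun t => s.indicator (fun _ => (1 : ℂ)) t * ξ n t)
        (Set.Icc a b) := fun n => by
      have := (hξi n).indicator hsm
      refine this.congr (Filter.Eventually.of_forall fun t => ?_)
      by_cases ht : t ∈ s <;> simp [ht]
    rw [hFint _ huint]
    have hlim : Filter.Tendsto (fun k => ∑ n ∈ Finset.range (q.natDegree + 1),
        ((q.coeff n : ℝ) : ℂ) * ∫ t in Set.Icc a b,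
          ((((p k).eval t) ^ (2 * n) : ℝ) : ℂ) * ξ n t) Filter.atTop
        (nhds (∑ n ∈ Finset.range (q.natDegree + 1),
        ((q.coeff n : ℝ) : ℂ) * ∫ t in Set.Icc a b, s.indicator (fun _ => (1 : ℂ)) t * ξ n t)) := by
      refine tendsto_finsetSum _ fun n _ => Filter.Tendsto.const_mul _ ?_
      by_cases hn : n = 0
      · rw [hξ0 n hn]; simp
      · refine tendsto_int_mul (hξi n) (C := 1)
          (f := fun k t => ((((p k).eval t) ^ (2 * n) : ℝ) : ℂ)) (fun k => by fun_prop)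
          (fun k t ht => ?_) ?_
        · rw [Complex.norm_real, norm_pow]
          exact pow_le_one₀ (norm_nonneg _) (hp k t ht).1
        · filter_upwards [hpl] with t ht
          have := (Complex.continuous_ofReal.tendsto _).comp (ht.pow (2 * n))
          by_cases hts : t ∈ s <;> simpa [hts, Function.comp_def, hn] using this
    refine NN.closed.mem_of_tendsto hlim (Filter.Eventually.of_forall fun k => ?_)
    have := pos_first e hX hs hW hc hsW hD hrep hq (h := p k) (fun t ht => (hp k t ht).1)
    have hcp : ∀ n : ℕ, Continuous (fun t => ((((p k).eval t) ^ n : ℝ) : ℂ)) := fun n => by fun_prop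
    rw [Finset.sum_congr rfl fun n _ => by rw [hξt n _ (hcp (2 * n))]] at this
    exact this
  have hfc : Continuous (fun t => (f t : ℂ)) := by fun_prop
  have e1 : trace e (fc (fun t => (f t : ℂ)) X * ((-Complex.I) •
      (aeval W (q.map (algebraMap ℝ ℂ)) * X - X * aeval W (q.map (algebraMap ℝ ℂ))))) =
      ∫ t in Set.Icc a b, (f t : ℂ) * F t := by
    rw [hFint _ fun n => cont_mul_int (hξi n) hfc]
    simp only [← hξt _ _ hfc]
    have h3 : fc (fun t => (f t : ℂ)) X * ((-Complex.I) •
      (aeval W (q.map (algebraMap ℝ ℂ)) * X - X * aeval W (q.map (algebraMap ℝ ℂ)))) =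
        ∑ n ∈ Finset.range (q.natDegree + 1), ((q.coeff n : ℝ) : ℂ) •
          (fc (fun t => (f t : ℂ)) X * ((-Complex.I) • (W ^ n * X - X * W ^ n))) := by
      rw [aeval_map_real, Finset.sum_mul, Finset.mul_sum, ← Finset.sum_sub_distrib,
        Finset.smul_sum, Finset.mul_sum]
      refine Finset.sum_congr rfl fun n _ => ?_
      simp only [smul_mul_assoc, mul_smul_comm, ← smul_sub]
      rw [smul_comm]
    rw [h3, tr_sum e _ fun n _ => ((hK n).left _).smul _]
    exact Finset.sum_congr rfl fun n _ => tr_smul _ _ _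
  rw [e1]
  have h4 : (fun t => (f t : ℂ) * F t) =ᵐ[volume.restrict (Set.Icc a b)]
      fun t => ((f t * (F t).re : ℝ) : ℂ) := by
    filter_upwards [hFpos] with t ht
    refine Complex.ext (by simp) (by simp [ht.1])
  rw [integral_congr_ae h4, integral_complex_ofReal]
  refine ⟨Complex.ofReal_im _, ?_⟩
  rw [Complex.ofReal_re]
  refine integral_nonneg_of_ae ?_
  filter_upwards [hFpos, ae_restrict_mem measurableSet_Icc] with t ht hti
  exact mul_nonneg (hf0 t hti) ht.2

end positivity

section positivity2
variable {X Y D2 : H →L[ℂ] H} {a b c : ℝ} {ι : Type*} (e : HilbertBasis ι ℂ H)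

theorem exists_antideriv {R : Type*} [Field R] [CharZero R] (p : R[X]) :
    ∃ q : R[X], derivative q = p := by
  induction p using Polynomial.induction_on' with
  | add p q hp hq =>
    obtain ⟨p', rfl⟩ := hp
    obtain ⟨q', rfl⟩ := hq
    exact ⟨p' + q', derivative_add⟩
  | monomial n r =>
    refine ⟨monomial (n + 1) (r / ((n : R) + 1)), ?_⟩
    rw [derivative_monomial]
    have : (n : R) + 1 ≠ 0 := Nat.cast_add_one_ne_zero n
    simp only [Nat.cast_add, Nat.cast_one, Nat.add_sub_cancel]
    rw [div_mul_cancel₀ _ this]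

theorem pos_third (hX : IsSelfAdjoint X) (hab : a ≤ b) (hs : spectrum ℝ X ⊆ Set.Icc a b)
    (hac : AC X) (hY : IsSelfAdjoint Y) (hsY : spectrum ℝ Y ⊆ Set.Icc a b)
    (hD : D2 = (-Complex.I) • (Y * X - X * Y))
    {Ω : Type} [MeasurableSpace Ω] {μ : Measure Ω} [SFinite μ] {u : Ω → H} (hrep : Rep μ u u D2)
    {p : ℝ[X]} (hp : ∀ t ∈ Set.Icc a b, 0 ≤ p.derivative.eval t)
    {f : ℝ → ℝ} (hf : Continuous f) (hf0 : ∀ t ∈ Set.Icc a b, 0 ≤ f t) :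
    NN (trace e (fc (fun t => (f t : ℂ)) X * ((-Complex.I) •
      (aeval Y (p.map (algebraMap ℝ ℂ)) * X - X * aeval Y (p.map (algebraMap ℝ ℂ)))))) := by
  set W : H →L[ℂ] H := Y - algebraMap ℝ (H →L[ℂ] H) a with hWdef
  have hWa : IsSelfAdjoint W := hY.sub (IsSelfAdjoint.algebraMap _ (IsSelfAdjoint.all a))
  have hsW : spectrum ℝ W ⊆ Set.Icc 0 (b - a) := by
    intro t ht
    have h1 : t + a ∈ spectrum ℝ Y := by
      rw [spectrum.add_mem_iff, neg_add_eq_sub]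
      exact ht
    have := hsY h1
    exact ⟨by linarith [this.1], by linarith [this.2]⟩
  have hWX : W * X - X * W = Y * X - X * Y := by
    rw [hWdef, sub_mul, mul_sub, Algebra.commutes a X, sub_sub_sub_cancel_right]
  have hq : aeval W ((p.comp (Polynomial.X + C a)).map (algebraMap ℝ ℂ)) =
      aeval Y (p.map (algebraMap ℝ ℂ)) := by
    rw [Polynomial.map_comp, aeval_comp]
    congr 1
    simp only [Polynomial.map_add, map_X, map_C, map_add, aeval_X, aeval_C]
    rw [hWdef]
    have : algebraMap ℂ (H →L[ℂ] H) (algebraMap ℝ ℂ a) = algebraMap ℝ (H →L[ℂ] H) a :=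
      (IsScalarTower.algebraMap_apply ℝ ℂ (H →L[ℂ] H) a).symm
    rw [this, sub_add_cancel]
  have := pos_second e hX hab hs hac hWa (sub_nonneg.2 hab) hsW (hWX ▸ hD) hrep
    (q := p.comp (Polynomial.X + C a)) (fun t ht => ?_) hf hf0
  · rwa [hq] at this
  · rw [derivative_comp]
    simp only [derivative_add, derivative_X, derivative_C, add_zero, one_mul, eval_comp, eval_add,
      eval_X, eval_C, mul_one]
    exact hp _ ⟨by linarith [ht.1], by linarith [ht.2]⟩

theorem pos_fourth (hX : IsSelfAdjoint X) (hab : a ≤ b) (hs : spectrum ℝ X ⊆ Set.Icc a b)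
    (hac : AC X) (hY : IsSelfAdjoint Y) (hsY : spectrum ℝ Y ⊆ Set.Icc a b)
    (hD : D2 = (-Complex.I) • (Y * X - X * Y))
    {Ω : Type} [MeasurableSpace Ω] {μ : Measure Ω} [SFinite μ] {u : Ω → H} (hrep : Rep μ u u D2)
    {P : (ℝ → ℂ) → Prop} (hP : P = MemC11 ∨ P = IsPolyFun) {ψ : ℝ → ℂ} (hψ : P ψ)
    (hpos : ∀ t ∈ Set.Icc a b, ∃ c : ℝ, 0 ≤ c ∧ deriv ψ t = (c : ℂ))
    {f : ℝ[X]} (hf0 : ∀ t ∈ Set.Icc a b, 0 ≤ f.eval t) :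
    NN (trace e (fc (fun t => ((f.eval t : ℝ) : ℂ)) X * ((-Complex.I) •
      (fc ψ Y * X - X * fc ψ Y)))) := by
  have hDn : IsNuc D2 := ⟨Ω, _, μ, u, u, inferInstance, hrep⟩
  have hYX : Y * X - X * Y = Complex.I • D2 := by
    rw [hD, smul_smul]; simp
  have hYXn : IsNuc (Y * X - X * Y) := by rw [hYX]; exact hDn.smul _
  have hXYn : IsNuc (X * Y - Y * X) := by rw [← neg_sub]; exact hYXn.neg
  obtain ⟨φ, hφ⟩ := exists_antideriv f
  set Φ := aeval X (φ.map (algebraMap ℝ ℂ)) with hΦ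
  have hM : IsNuc (Φ * Y - Y * Φ) := by
    rw [← neg_sub]; exact (comm_poly e hYXn _).1.neg
  set M := Φ * Y - Y * Φ with hMdef
  -- the identity
  have key : ∀ (Q : (ℝ → ℂ) → Prop) (hQ : Q = MemC11 ∨ Q = IsPolyFun) (χ : ℝ → ℂ) (hχ : Q χ),
      trace e (fc (fun t => ((f.eval t : ℝ) : ℂ)) X * ((-Complex.I) • (fc χ Y * X - X * fc χ Y))) =
        Complex.I * trace e (fc (deriv χ) Y * M) := by
    intro Q hQ χ hχ
    obtain ⟨-, -, -, h1, -⟩ := comm_fc e hY hXYn hQ hχ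
    have h2 : IsNuc (fc χ Y * X - X * fc χ Y) := by rw [← neg_sub]; exact h1.neg
    have h3 := (comm_poly e h2 (φ.map (algebraMap ℝ ℂ))).2
    obtain ⟨-, -, -, -, h4⟩ := comm_fc e hY hM hQ hχ
    have hff : aeval X (f.map (algebraMap ℝ ℂ)) = fc (fun t => ((f.eval t : ℝ) : ℂ)) X := by
      rw [← fc_poly hX]; congr 1; ext t; rw [eval_map_ofReal]
    rw [derivative_map, hφ, hff, ← hΦ] at h3
    rw [mul_smul_comm, tr_smul, ← h3, ← h4, ← neg_sub, tr_neg]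
    ring
  rw [key P hP ψ hψ]
  obtain ⟨-, -, hdc, -, -⟩ := comm_fc e hY hXYn hP hψ
  -- approximation
  have happ : ∀ n : ℕ, ∃ g : ℝ[X], (∀ t ∈ Set.Icc a b, 0 ≤ g.eval t) ∧
      ∀ t ∈ Set.Icc a b, ‖((g.eval t : ℝ) : ℂ) - deriv ψ t‖ ≤ 2 * (1 / ((n : ℝ) + 1)) := by
    intro n
    have hn : (0 : ℝ) < 1 / ((n : ℝ) + 1) := by positivity
    obtain ⟨g, hg⟩ := weierstrass_real (f := fun t => (deriv ψ t).re)
      (Complex.continuous_re.comp hdc) a b hn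
    refine ⟨g + C (1 / ((n : ℝ) + 1)), fun t ht => ?_, fun t ht => ?_⟩
    all_goals
      obtain ⟨c, hc, hc'⟩ := hpos t ht
      have h1 := abs_lt.1 (hg t ht)
      rw [hc', Complex.ofReal_re] at h1
      rw [eval_add, eval_C]
    · linarith
    · rw [hc', ← Complex.ofReal_sub, Complex.norm_real, Real.norm_eq_abs, abs_le]
      constructor <;> linarith
  choose g hg0 hg1 using happ
  have hlim : Filter.Tendsto (fun n => Complex.I *
      trace e (fc (fun t => (((g n).eval t : ℝ) : ℂ)) Y * M)) Filter.atTop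
      (nhds (Complex.I * trace e (fc (deriv ψ) Y * M))) := by
    refine Filter.Tendsto.const_mul _ ?_
    rw [tendsto_iff_norm_sub_tendsto_zero]
    have h0 : Filter.Tendsto (fun n : ℕ => 2 * (1 / ((n : ℝ) + 1)) * traceNorm e M) Filter.atTop
        (nhds 0) := by
      have := ((tendsto_one_div_add_atTop_nhds_zero_nat (𝕜 := ℝ)).const_mul 2).mul_const
        (traceNorm e M)
      simpa using this
    refine squeeze_zero (fun n => norm_nonneg _) (fun n => ?_) h0
    rw [← tr_sub e (hM.left _) (hM.left _), ← sub_mul, ← fc_sub (by fun_prop) hdc]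
    refine (norm_trace_le e hM _).trans ?_
    refine mul_le_mul_of_nonneg_right (fc_norm_le hY hsY (by positivity) (hg1 n)) ?_
    have := norm_trace_le e hM (0 : H →L[ℂ] H)
    exact tsum_nonneg fun i => ((ContinuousLinearMap.nonneg_iff_isPositive _).1
      (absOp_nonneg M)).re_inner_nonneg_right _
  refine NN.closed.mem_of_tendsto hlim (Filter.Eventually.of_forall fun n => ?_)
  obtain ⟨p, hp⟩ := exists_antideriv (g n)
  have h5 := pos_third e hX hab hs hac hY hsY hD hrep (p := p) (by rw [hp]; exact hg0 n)
    (f := fun t => f.eval t) (by fun_prop) hf0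
  rw [← fc_poly hY, key IsPolyFun (Or.inr rfl) _ ⟨p.map (algebraMap ℝ ℂ), fun t => rfl⟩,
    deriv_polyFun, derivative_map, hp] at h5
  simp only [eval_map_ofReal] at h5
  exact h5

end positivity2

section classes
variable {a b : ℝ}

theorem memC11_schwartz (f : SchwartzMap ℝ ℂ) : MemC11 f := by
  set F : SchwartzMap ℝ ℂ := FourierTransform.fourier f with hF
  have hinv : ∀ β : ℝ, f β = ∫ v : ℝ, Complex.exp ((2 * Real.pi * (v * β) : ℝ) * Complex.I) * F v := by
    intro β
    have h1 : FourierTransformInv.fourierInv F = f := FourierTransform.fourierInv_fourier_eq f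
    have h2 : (FourierTransformInv.fourierInv F : SchwartzMap ℝ ℂ) β =
        FourierTransformInv.fourierInv (F : ℝ → ℂ) β := by
      rw [← SchwartzMap.fourierInv_coe]
    rw [h1, Real.fourierInv_eq'] at h2
    rw [h2]
    refine integral_congr_ae (Filter.Eventually.of_forall fun v => ?_)
    simp [mul_comm β v]
  have hpi : (2 * Real.pi)⁻¹ ≠ 0 := by positivity
  have hF1 : Integrable (fun α : ℝ => α • F α) := by
    refine (F.integrable_pow_mul volume 1).mono (by fun_prop) (Filter.Eventually.of_forall fun x => ?_)
    simp
  refine ⟨fun α => ((Real.sqrt (2 * Real.pi) * (2 * Real.pi)⁻¹ : ℝ) : ℂ) * F ((2 * Real.pi)⁻¹ * α),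
    ?_, ?_, fun β => ?_⟩
  · exact ((F.integrable (μ := volume)).comp_mul_left' hpi).const_mul _
  · have := (hF1.comp_mul_left' hpi).const_mul
      ((Real.sqrt (2 * Real.pi) * (2 * Real.pi)⁻¹ * (2 * Real.pi) : ℝ) : ℂ)
    refine this.congr (Filter.Eventually.of_forall fun α => ?_)
    have h0 : (Real.pi : ℂ) ≠ 0 := by exact_mod_cast Real.pi_ne_zero
    simp only [Complex.real_smul]
    push_cast
    field_simp
  · have h1 := Measure.integral_comp_mul_left (fun v : ℝ =>
      Complex.exp ((2 * Real.pi * (v * β) : ℝ) * Complex.I) * F v) (2 * Real.pi)⁻¹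
    rw [← hinv β] at h1
    have h2 : (∫ α : ℝ, Complex.exp (Complex.I * (α : ℂ) * (β : ℂ)) •
        (((Real.sqrt (2 * Real.pi) * (2 * Real.pi)⁻¹ : ℝ) : ℂ) * F ((2 * Real.pi)⁻¹ * α))) =
        ((Real.sqrt (2 * Real.pi) * (2 * Real.pi)⁻¹ : ℝ) : ℂ) *
          ∫ α : ℝ, Complex.exp ((2 * Real.pi * ((2 * Real.pi)⁻¹ * α * β) : ℝ) * Complex.I) *
            F ((2 * Real.pi)⁻¹ * α) := by
      rw [← integral_const_mul]
      refine integral_congr_ae (Filter.Eventually.of_forall fun α => ?_)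
      have h3 : 2 * Real.pi * ((2 * Real.pi)⁻¹ * α * β) = α * β := by
        have := Real.pi_ne_zero
        field_simp
      simp only [smul_eq_mul]
      rw [h3]
      have h4 : ((α * β : ℝ) : ℂ) * Complex.I = Complex.I * α * β := by push_cast; ring
      rw [h4]; ring
    rw [h2, h1, inv_inv, abs_of_pos (by positivity), Complex.real_smul, Complex.real_smul,
      ← mul_assoc, ← mul_assoc, ← Complex.ofReal_mul, ← Complex.ofReal_mul]
    have h5 : (Real.sqrt (2 * Real.pi))⁻¹ * (Real.sqrt (2 * Real.pi) * (2 * Real.pi)⁻¹) *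
        (2 * Real.pi) = 1 := by
      have : Real.sqrt (2 * Real.pi) ≠ 0 := by positivity
      have := Real.pi_ne_zero
      field_simp
    rw [mul_assoc (Real.sqrt (2 * Real.pi))⁻¹, ← mul_assoc, h5]
    simp

theorem exists_class_antideriv {P : (ℝ → ℂ) → Prop} (hP : P = MemC11 ∨ P = IsPolyFun) (a b : ℝ)
    (p : ℂ[X]) : ∃ φ : ℝ → ℂ, P φ ∧ ∀ t ∈ Set.Icc a b, deriv φ t = p.eval (t : ℂ) := by
  obtain ⟨q, rfl⟩ := exists_antideriv p
  rcases hP with rfl | rfl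
  · set R : ℝ := |a| + |b| + 1
    have hR : 0 < R := by positivity
    let B : ContDiffBump (0 : ℝ) := ⟨R, R + 1, hR, by linarith⟩
    have hq : ContDiff ℝ ⊤ (fun t : ℝ => q.eval (t : ℂ)) := by
      have h1 : ContDiff ℂ ⊤ (fun z : ℂ => q.eval z) := by
        have h2 := q.contDiff_aeval (𝕜 := ℂ) ⊤
        simp only [coe_aeval_eq_eval] at h2
        exact h2
      exact (h1.restrict_scalars ℝ).comp Complex.ofRealCLM.contDiff
    have hf2 : ContDiff ℝ (⊤ : ℕ∞) (fun t : ℝ => ((B t : ℝ) : ℂ) * q.eval (t : ℂ)) :=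
      (Complex.ofRealCLM.contDiff.comp B.contDiff).mul (hq.of_le le_top)
    have hf1 : HasCompactSupport (fun t : ℝ => ((B t : ℝ) : ℂ) * q.eval (t : ℂ)) :=
      (B.hasCompactSupport.comp_left Complex.ofReal_zero).mul_right
    refine ⟨_, memC11_schwartz (hf1.toSchwartzMap hf2), fun t ht => ?_⟩
    have ht' : t ∈ Metric.ball (0 : ℝ) R := by
      rw [mem_ball_zero_iff, Real.norm_eq_abs, abs_lt]
      have h1 := neg_abs_le a
      have h2 := le_abs_self b
      have h3 := abs_nonneg a
      have h4 := abs_nonneg b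
      constructor <;> simp only [R] <;> linarith [ht.1, ht.2]
    have hev : (hf1.toSchwartzMap hf2 : ℝ → ℂ) =ᶠ[nhds t] fun t => q.eval (t : ℂ) := by
      filter_upwards [Metric.isOpen_ball.mem_nhds ht'] with s hs
      have : B s = 1 := B.one_of_mem_closedBall (Metric.ball_subset_closedBall hs)
      simp [this]
    rw [hev.deriv_eq, deriv_polyFun]
  · exact ⟨fun t => q.eval (t : ℂ), ⟨q, fun t => rfl⟩, fun t _ => by rw [deriv_polyFun]⟩

theorem cont_zero_of_poly {ξ : ℝ → ℂ} (hξ : IntegrableOn ξ (Set.Icc a b))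
    (h : ∀ p : ℂ[X], ∫ t in Set.Icc a b, p.eval (t : ℂ) * ξ t = 0) (f : ℝ → ℂ) (hf : Continuous f) :
    ∫ t in Set.Icc a b, f t * ξ t = 0 := by
  have happ : ∀ n : ℕ, ∃ p : ℂ[X], ∀ t ∈ Set.Icc a b,
      ‖p.eval (t : ℂ) - f t‖ < 1 / ((n : ℝ) + 1) := fun n => weierstrass hf a b (by positivity)
  choose p hp using happ
  obtain ⟨C, hC⟩ := (isCompact_Icc (a := a) (b := b)).exists_bound_of_continuousOn hf.continuousOn
  have := tendsto_int_mul hξ (f := fun n t => (p n).eval (t : ℂ)) (g := f) (C := C + 1)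
    (fun n => by fun_prop) (fun n t ht => ?_) ?_
  · simp only [h] at this
    exact (tendsto_nhds_unique this tendsto_const_nhds)
  · have h1 : ‖(p n).eval (t : ℂ)‖ ≤ ‖(p n).eval (t : ℂ) - f t‖ + ‖f t‖ := by
      simpa using norm_add_le ((p n).eval (t : ℂ) - f t) (f t)
    have h2 : 1 / ((n : ℝ) + 1) ≤ 1 := by
      rw [div_le_one (by positivity)]; linarith [n.cast_nonneg (α := ℝ)]
    linarith [hC t ht, hp n t ht]
  · filter_upwards [ae_restrict_mem measurableSet_Icc] with t ht
    rw [tendsto_iff_norm_sub_tendsto_zero]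
    exact squeeze_zero (fun n => norm_nonneg _) (fun n => (hp n t ht).le)
      tendsto_one_div_add_atTop_nhds_zero_nat

end classes

theorem statement9 {ι : Type*} (e : HilbertBasis ι ℂ H) (X Y D2 : H →L[ℂ] H)
    (a b : ℝ) (hA : AssumptionA e X Y D2 a b)
    (P : (ℝ → ℂ) → Prop) (hP : P = MemC11 ∨ P = IsPolyFun)
    (ψ : ℝ → ℂ) (hψ : P ψ) :
    ∃ ξ : ℝ → ℂ, IntegrableOn ξ (Set.Icc a b) ∧
      (∀ φ : ℝ → ℂ, P φ →
        (-Complex.I) * trace e (fc ψ Y * fc φ X - fc φ X * fc ψ Y) =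
          ∫ t in Set.Icc a b, deriv φ t * ξ t) ∧
      (∫ t in Set.Icc a b, ‖ξ t‖) ≤
        traceNorm e ((-Complex.I) • (fc ψ Y * X - X * fc ψ Y)) ∧
      (∫ t in Set.Icc a b, ξ t) = trace e (fc (deriv ψ) Y * D2) ∧
      ((∀ t ∈ Set.Icc a b, ∃ c : ℝ, 0 ≤ c ∧ deriv ψ t = (c : ℂ)) →
        ∀ᵐ t ∂(volume : Measure ℝ), t ∈ Set.Icc a b → (ξ t).im = 0 ∧ 0 ≤ (ξ t).re) ∧
      ∀ ξ' : ℝ → ℂ, IntegrableOn ξ' (Set.Icc a b) →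
        (∀ φ : ℝ → ℂ, P φ →
          (-Complex.I) * trace e (fc ψ Y * fc φ X - fc φ X * fc ψ Y) =
            ∫ t in Set.Icc a b, deriv φ t * ξ' t) →
        ∀ᵐ t ∂(volume : Measure ℝ), t ∈ Set.Icc a b → ξ' t = ξ t := by
  obtain ⟨hab, hX, hY, hpure, hD2, hpos, htc, hsX, hsY⟩ := hA
  have hD : D2 = (-Complex.I) • (Y * X - X * Y) := by
    have h2 : (2 : ℂ) ≠ 0 := two_ne_zero
    have h1 : (2 : ℂ)⁻¹ • (2 : ℂ) • D2 = (2 : ℂ)⁻¹ • ((-(2 : ℂ) * Complex.I) • (Y * X - X * Y)) := by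
      rw [hD2]
    rw [smul_smul, smul_smul, inv_mul_cancel₀ h2, one_smul] at h1
    rw [h1]
    congr 1
    rw [neg_mul, mul_neg, ← mul_assoc, inv_mul_cancel₀ h2, one_mul]
  have hD0 : 0 ≤ D2 := (ContinuousLinearMap.nonneg_iff_isPositive _).2 hpos
  have habs : absOp D2 = D2 := by
    have h1 := absOp_mul_self D2
    rw [ContinuousLinearMap.isSelfAdjoint_iff'.1 hD0.isSelfAdjoint] at h1
    rw [← CFC.sqrt_unique h1 (absOp_nonneg D2), CFC.sqrt_unique rfl hD0]
  obtain ⟨S, hS, hSS, hSn⟩ := exists_sqrt hD0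
  have hsum : Summable fun i => ‖S (e i)‖ ^ 2 := by
    have h1 := htc
    rw [IsTraceClass, habs] at h1
    exact h1.congr fun i => (hSn (e i)).symm
  obtain ⟨Ω, m, μ, u, hsf, hrep, -⟩ := rep_of_sqrt e hS hsum
  rw [hSS] at hrep
  have hac : AC X := fun N hN hN0 f hf x => ac2 hX hY hS hSS hD hab hsX hpure hN hN0 hf x
  have hDn : IsNuc D2 := ⟨Ω, m, μ, u, u, hsf, hrep⟩
  have hXY : X * Y - Y * X = (-Complex.I) • D2 := by
    rw [hD, smul_smul, ← neg_sub]; simp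
  have hXYn : IsNuc (X * Y - Y * X) := by rw [hXY]; exact hDn.smul _
  obtain ⟨-, -, hdψ, hψn, hψt⟩ := comm_fc e hY hXYn hP hψ
  have hψn' : IsNuc (fc ψ Y * X - X * fc ψ Y) := by rw [← neg_sub]; exact hψn.neg
  have hK : IsNuc ((-Complex.I) • (fc ψ Y * X - X * fc ψ Y)) := hψn'.smul _
  obtain ⟨ξ, hξ, hξf⟩ := nuc_density hX hab hsX hac hK e
  have hmain : ∀ φ : ℝ → ℂ, P φ →
        (-Complex.I) * trace e (fc ψ Y * fc φ X - fc φ X * fc ψ Y) =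
          ∫ t in Set.Icc a b, deriv φ t * ξ t := by
    intro φ hφ
    obtain ⟨-, -, hdφ, -, hφt⟩ := comm_fc e hX hψn' hP hφ
    rw [hφt, ← hξf _ hdφ, mul_smul_comm, tr_smul]
  refine ⟨ξ, hξ, hmain, ?_, ?_, ?_, ?_⟩
  · refine norm_bound_of_cont hξ fun f hf hf1 => ?_
    rw [← hξf f hf]
    refine (norm_trace_le e hK _).trans ?_
    refine mul_le_of_le_one_left ?_ (fc_norm_le hX hsX zero_le_one fun t _ => hf1 t)
    exact tsum_nonneg fun i => ((ContinuousLinearMap.nonneg_iff_isPositive _).1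
      (absOp_nonneg _)).re_inner_nonneg_right _
  · have h1 := hξf (fun _ => 1) continuous_const
    simp only [one_mul] at h1
    rw [← h1, fc_one hX, one_mul, ← neg_sub, smul_neg, tr_neg, tr_smul, hψt, hXY, mul_smul_comm,
      tr_smul]
    rw [← mul_assoc]
    simp
  · intro hψpos
    have h1 := ae_nonneg_of_cont hξ fun f hf hf0 hf1 => by
      have happ : ∀ n : ℕ, ∃ g : ℝ[X], (∀ t ∈ Set.Icc a b, 0 ≤ g.eval t) ∧
          ∀ t ∈ Set.Icc a b, |g.eval t - f t| ≤ 2 * (1 / ((n : ℝ) + 1)) := by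
        intro n
        have hn : (0 : ℝ) < 1 / ((n : ℝ) + 1) := by positivity
        obtain ⟨g, hg⟩ := weierstrass_real hf a b hn
        refine ⟨g + C (1 / ((n : ℝ) + 1)), fun t ht => ?_, fun t ht => ?_⟩
        all_goals
          have h1 := abs_lt.1 (hg t ht)
          rw [eval_add, eval_C]
        · linarith [hf0 t]
        · rw [abs_le]
          constructor <;> linarith
      choose g hg0 hg1 using happ
      have hlim := tendsto_int_mul hξ (f := fun n t => (((g n).eval t : ℝ) : ℂ))
        (g := fun t => (f t : ℂ)) (C := 3) (fun n => by fun_prop) (fun n t ht => by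
          rw [Complex.norm_real, Real.norm_eq_abs, abs_of_nonneg (hg0 n t ht)]
          have h2 : 1 / ((n : ℝ) + 1) ≤ 1 := by
            rw [div_le_one (by positivity)]; linarith [n.cast_nonneg (α := ℝ)]
          linarith [hf1 t, (abs_le.1 (hg1 n t ht)).2]) (by
          filter_upwards [ae_restrict_mem measurableSet_Icc] with t ht
          refine (Complex.continuous_ofReal.tendsto _).comp ?_
          rw [tendsto_iff_norm_sub_tendsto_zero]
          refine squeeze_zero (fun n => norm_nonneg _) (fun n => hg1 n t ht) ?_
          simpa using (tendsto_one_div_add_atTop_nhds_zero_nat (𝕜 := ℝ)).const_mul 2)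
      refine NN.closed.mem_of_tendsto hlim (Filter.Eventually.of_forall fun n => ?_)
      have h5 := pos_fourth e hX hab hsX hac hY hsY hD hrep hP hψ hψpos (hg0 n)
      rw [hξf _ (by fun_prop)] at h5
      exact h5
    exact (ae_restrict_iff' measurableSet_Icc).1 h1
  · intro ξ' hξ' hmain'
    have hd : IntegrableOn (fun t => ξ' t - ξ t) (Set.Icc a b) := hξ'.sub hξ
    have h0 := ae_zero_of_cont hd (cont_zero_of_poly hd fun p => by
      obtain ⟨φ, hφ, hφp⟩ := exists_class_antideriv hP a b p
      have hp : Continuous fun t : ℝ => p.eval (t : ℂ) := by fun_prop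
      have hc : ∀ η : ℝ → ℂ, ∫ t in Set.Icc a b, deriv φ t * η t =
          ∫ t in Set.Icc a b, p.eval (t : ℂ) * η t := fun η =>
        setIntegral_congr_fun measurableSet_Icc fun t ht => by simp only [hφp t ht]
      have h1 := (hmain' φ hφ).symm.trans (hmain φ hφ)
      rw [hc, hc] at h1
      simp only [mul_sub]
      rw [integral_sub (cont_mul_int hξ' hp) (cont_mul_int hξ hp), h1, sub_self])
    filter_upwards [h0] with t ht hm
    exact sub_eq_zero.1 (ht hm)

end HHCP
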